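/- arXiv:2302.03098 — 5 statements merged into one kernel-verified Lean document; each statement's English description precedes it below -/
import Mathlib

section
/- For every t ∈ ℝ, the functions f̂_d(t) = (Γ(d/2) / (Γ((d−1)/2) √(π d))) · (1 − t²/d)^{(d−3)/2} for |t| ≤ √d (and f̂_d(t) = 0 for |t| > √d) converge pointwise as d → ∞ to the standard normal density: lim_{d→∞} f̂_d(t) = (1/√(2π)) e^{−t²/2}. -/
open MeasureTheory ProbabilityTheory Real Filter
open scoped InnerProductSpace Topology ENNReal

theorem aux_gamma_half (y : ℝ) (hy : 0 < y) :
    Real.Gamma (y + 1 / 2) ^ 2 ≤ y * Real.Gamma y ^ 2 := by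
  have h := Real.Gamma_mul_add_mul_le_rpow_Gamma_mul_rpow_Gamma (s := y) (t := y + 1)
    (a := 1 / 2) (b := 1 / 2) hy (by linarith) (by norm_num) (by norm_num) (by norm_num)
  have e : (1 / 2 : ℝ) * y + 1 / 2 * (y + 1) = y + 1 / 2 := by ring
  rw [e, ← Real.sqrt_eq_rpow, ← Real.sqrt_eq_rpow] at h
  have h0 : 0 < Real.Gamma y := Real.Gamma_pos_of_pos hy
  have h1 : 0 < Real.Gamma (y + 1) := Real.Gamma_pos_of_pos (by linarith)
  have h2 : 0 < Real.Gamma (y + 1 / 2) := Real.Gamma_pos_of_pos (by linarith)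
  calc Real.Gamma (y + 1 / 2) ^ 2 ≤ (√(Real.Gamma y) * √(Real.Gamma (y + 1))) ^ 2 := by
        gcongr
    _ = Real.Gamma y * Real.Gamma (y + 1) := by
        rw [mul_pow, Real.sq_sqrt h0.le, Real.sq_sqrt h1.le]
    _ = y * Real.Gamma y ^ 2 := by rw [Real.Gamma_add_one hy.ne']; ring

theorem aux_lin (c : ℝ) : Tendsto (fun d : ℕ => (1 - c / (d : ℝ)) / (2 * π)) atTop
    (𝓝 (2 * π)⁻¹) := by
  have h : Tendsto (fun d : ℕ => c / (d : ℝ)) atTop (𝓝 0) :=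
    tendsto_const_div_atTop_nhds_zero_nat c
  have h2 := (h.const_sub 1).div_const (2 * π)
  simpa using h2

theorem aux_ratio : Tendsto (fun d : ℕ =>
    Real.Gamma ((d : ℝ) / 2) / (Real.Gamma (((d : ℝ) - 1) / 2) * Real.sqrt (π * d)))
    atTop (𝓝 (Real.sqrt (2 * π))⁻¹) := by
  have key : Tendsto (fun d : ℕ =>
      (Real.Gamma ((d : ℝ) / 2) / (Real.Gamma (((d : ℝ) - 1) / 2) * Real.sqrt (π * d))) ^ 2)
      atTop (𝓝 (2 * π)⁻¹) := by
    refine tendsto_of_tendsto_of_tendsto_of_le_of_le' (aux_lin 2) (aux_lin 1) ?_ ?_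
    · filter_upwards [eventually_ge_atTop 4] with d hd
      have hd' : (4 : ℝ) ≤ d := by exact_mod_cast hd
      have hG : 0 < Real.Gamma (((d : ℝ) - 1) / 2) := Real.Gamma_pos_of_pos (by linarith)
      have hp := Real.pi_pos
      have h := aux_gamma_half ((d : ℝ) / 2 - 1) (by linarith)
      have e1 : (d : ℝ) / 2 - 1 + 1 / 2 = ((d : ℝ) - 1) / 2 := by ring
      have e2 : Real.Gamma ((d : ℝ) / 2) = ((d : ℝ) / 2 - 1) * Real.Gamma ((d : ℝ) / 2 - 1) := by
        rw [← Real.Gamma_add_one (by linarith)]; congr 1; ring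
      rw [e1] at h
      rw [div_pow, mul_pow, Real.sq_sqrt (by positivity), le_div_iff₀ (by positivity), e2]
      have e3 : (1 - 2 / (d : ℝ)) / (2 * π) * (Real.Gamma (((d : ℝ) - 1) / 2) ^ 2 * (π * d))
          = ((d : ℝ) / 2 - 1) * Real.Gamma (((d : ℝ) - 1) / 2) ^ 2 := by
        field_simp
      rw [e3]
      calc _ ≤ ((d : ℝ) / 2 - 1) * (((d : ℝ) / 2 - 1) * Real.Gamma ((d : ℝ) / 2 - 1) ^ 2) :=
            mul_le_mul_of_nonneg_left h (by linarith)
        _ = _ := by ring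
    · filter_upwards [eventually_ge_atTop 4] with d hd
      have hd' : (4 : ℝ) ≤ d := by exact_mod_cast hd
      have hG : 0 < Real.Gamma (((d : ℝ) - 1) / 2) := Real.Gamma_pos_of_pos (by linarith)
      have hp := Real.pi_pos
      have h := aux_gamma_half (((d : ℝ) - 1) / 2) (by linarith)
      have e1 : ((d : ℝ) - 1) / 2 + 1 / 2 = (d : ℝ) / 2 := by ring
      rw [e1] at h
      rw [div_pow, mul_pow, Real.sq_sqrt (by positivity), div_le_iff₀ (by positivity)]
      refine h.trans (le_of_eq ?_)
      field_simp
  have h2 := (Real.continuous_sqrt.tendsto _).comp key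
  rw [Real.sqrt_inv] at h2
  refine h2.congr' ?_
  filter_upwards [eventually_ge_atTop 4] with d hd
  have hd' : (4 : ℝ) ≤ d := by exact_mod_cast hd
  have hG : 0 < Real.Gamma (((d : ℝ) - 1) / 2) := Real.Gamma_pos_of_pos (by linarith)
  have hG' : 0 < Real.Gamma ((d : ℝ) / 2) := Real.Gamma_pos_of_pos (by linarith)
  simp only [Function.comp]
  exact Real.sqrt_sq (by positivity)

theorem aux_exp (t : ℝ) : Tendsto (fun d : ℕ => (1 - t ^ 2 / (d : ℝ)) ^ (((d : ℝ) - 3) / 2))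
    atTop (𝓝 (Real.exp (-t ^ 2 / 2))) := by
  have hg : Tendsto (fun x : ℝ => x * (-t ^ 2 / (2 * x + 3))) atTop (𝓝 (-t ^ 2 / 2)) := by
    have h1 : Tendsto (fun x : ℝ => 3 / x) atTop (𝓝 0) := tendsto_const_nhds.div_atTop tendsto_id
    have h2 : Tendsto (fun x : ℝ => -t ^ 2 / (2 + 3 / x)) atTop (𝓝 (-t ^ 2 / (2 + 0))) :=
      tendsto_const_nhds.div (h1.const_add 2) (by norm_num)
    rw [add_zero] at h2
    refine h2.congr' ?_
    filter_upwards [eventually_gt_atTop 0] with x hx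
    field_simp
  have h := Real.tendsto_one_add_rpow_exp_of_tendsto hg
  have hd : Tendsto (fun d : ℕ => ((d : ℝ) - 3) / 2) atTop atTop :=
    (tendsto_atTop_add_const_right _ (-3) tendsto_natCast_atTop_atTop).atTop_div_const
      (by norm_num)
  refine (h.comp hd).congr fun d => ?_
  simp only [Function.comp]
  congr 1
  rw [show 2 * (((d : ℝ) - 3) / 2) + 3 = d by ring]
  ring

/-- For every `t ∈ ℝ`, the densities
`f̂_d(t) = Γ(d/2) / (Γ((d-1)/2) √(πd)) · (1 - t²/d)^{(d-3)/2}` for `|t| ≤ √d`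
(and `f̂_d(t) = 0` for `|t| > √d`) converge pointwise as `d → ∞` to the standard
normal density: `lim_{d→∞} f̂_d(t) = (1/√(2π)) e^{-t²/2}`. -/
theorem rescaled_cosine_pdf_tendsto_gaussian (t : ℝ) :
    Tendsto (fun d : ℕ =>
        if |t| ≤ Real.sqrt d then
          Real.Gamma ((d : ℝ) / 2) / (Real.Gamma (((d : ℝ) - 1) / 2) * Real.sqrt (π * d)) *
            (1 - t ^ 2 / d) ^ (((d : ℝ) - 3) / 2)
        else 0)
      atTop (𝓝 ((Real.sqrt (2 * π))⁻¹ * Real.exp (-t ^ 2 / 2))) := by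
  refine ((aux_ratio.mul (aux_exp t))).congr' ?_
  have : Tendsto (fun d : ℕ => Real.sqrt (d : ℝ)) atTop atTop :=
    Real.tendsto_sqrt_atTop.comp tendsto_natCast_atTop_atTop
  filter_upwards [this.eventually_ge_atTop |t|] with d hd
  rw [if_pos hd]
end

section
/- Under the one-shot random-canary setup, Var[‖ρ‖²] = 4k‖X‖²/d + 4σ²‖X‖² + 2k(k−1)/d + 4kσ² + 2σ⁴d. -/
open MeasureTheory ProbabilityTheory Real Filter
open scoped InnerProductSpace Topology ENNReal

/-- The standard Gaussian measure `N(0, I_d)` on `ℝ^d`, obtained by mapping the product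
of `d` independent one-dimensional standard Gaussians onto `EuclideanSpace ℝ (Fin d)`. -/
noncomputable def stdGaussianE (d : ℕ) : Measure (EuclideanSpace ℝ (Fin d)) :=
  Measure.map (⇑(EuclideanSpace.equiv (Fin d) ℝ).symm)
    (Measure.pi fun _ : Fin d => gaussianReal 0 1)

/-- The joint distribution of `k` i.i.d. canaries `c_1, …, c_k` drawn from the
(uniform) measure `μs` on the unit sphere, together with an independent standard
Gaussian vector `Z ∼ N(0, I_d)`.  A sample point is `ω = ((c_1, …, c_k), Z)`. -/
noncomputable def canaryP (d k : ℕ) (μs : Measure (EuclideanSpace ℝ (Fin d))) :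
    Measure ((Fin k → EuclideanSpace ℝ (Fin d)) × EuclideanSpace ℝ (Fin d)) :=
  (Measure.pi fun _ : Fin k => μs).prod (stdGaussianE d)

/-- The mechanism output `ρ = X + ∑_{i=1}^k c_i + σ Z`. -/
noncomputable def rhoF (d k : ℕ) (X : EuclideanSpace ℝ (Fin d)) (σ : ℝ)
    (ω : (Fin k → EuclideanSpace ℝ (Fin d)) × EuclideanSpace ℝ (Fin d)) :
    EuclideanSpace ℝ (Fin d) :=
  X + (∑ i, ω.1 i) + σ • ω.2


lemma aux_gauss_four : ∫ x, x ^ 4 ∂(gaussianReal 0 1) = 3 := by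
  have hint : ∀ n : ℕ, Integrable (fun x : ℝ => x ^ n) (gaussianReal 0 1) := by
    intro n
    have h := (memLp_id_gaussianReal' (μ := 0) (v := 1) (n : ℝ≥0∞) (by simp))
    by_cases hn : n = 0
    · subst hn; simp
    have h2 := h.integrable_norm_pow hn
    refine h2.mono (by fun_prop) (Eventually.of_forall fun x => by simp)
  have h1 : ∫ x, x ∂(gaussianReal 0 1) = 0 := integral_id_gaussianReal
  have h2 : ∫ x, x ^ 2 ∂(gaussianReal 0 1) = 1 := by
    have := variance_fun_id_gaussianReal (μ := 0) (v := 1)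
    rw [variance_eq_integral (by fun_prop)] at this
    simpa using this
  have hc := gaussianReal_conv_gaussianReal (m₁ := 0) (m₂ := 0) (v₁ := 1) (v₂ := 1)
  have hm := gaussianReal_map_const_mul (μ := 0) (v := 1) (√2)
  have e : gaussianReal (√2 * 0) (NNReal.mk (√2 ^ 2) (sq_nonneg _) * 1) = gaussianReal (0 + 0) (1 + 1) := by
    congr 1
    · simp
    · apply NNReal.coe_injective
      rw [NNReal.coe_mul, NNReal.coe_mk]
      norm_num
  rw [e, ← hc] at hm
  have key : ∫ x, x ^ 4 ∂((gaussianReal 0 1).map (√2 * ·)) = ∫ x, x ^ 4 ∂((gaussianReal 0 1) ∗ (gaussianReal 0 1)) := by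
    rw [hm]
  have s4 : √2 ^ 4 = 4 := by
    rw [show (4 : ℕ) = 2 * 2 from rfl, pow_mul]; norm_num
  rw [integral_map (by fun_prop) (by fun_prop), Measure.conv, integral_map (by fun_prop) (by fun_prop)] at key
  simp_rw [mul_pow, s4] at key
  rw [integral_const_mul] at key
  have expand : ∀ z : ℝ × ℝ, (z.1 + z.2) ^ 4 = z.1 ^ 4 * z.2 ^ 0 + 4 * (z.1 ^ 3 * z.2 ^ 1)
     + 6 * (z.1 ^ 2 * z.2 ^ 2) + 4 * (z.1 ^ 1 * z.2 ^ 3) + z.1 ^ 0 * z.2 ^ 4 := by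
    intro z; ring
  have I : ∀ m n : ℕ, Integrable (fun z : ℝ × ℝ => z.1 ^ m * z.2 ^ n)
      ((gaussianReal 0 1).prod (gaussianReal 0 1)) := fun m n => (hint m).mul_prod (hint n)
  have V : ∀ m n : ℕ, ∫ z : ℝ × ℝ, z.1 ^ m * z.2 ^ n ∂((gaussianReal 0 1).prod (gaussianReal 0 1))
      = (∫ x, x ^ m ∂(gaussianReal 0 1)) * ∫ x, x ^ n ∂(gaussianReal 0 1) :=
    fun m n => integral_prod_mul (fun x : ℝ => x ^ m) (fun x : ℝ => x ^ n)
  simp_rw [expand] at key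
  have i1 := I 4 0
  have i2 := (I 3 1).const_mul 4
  have i3 := (I 2 2).const_mul 6
  have i4 := (I 1 3).const_mul 4
  have i5 := I 0 4
  rw [integral_add (((i1.fun_add i2).fun_add i3).fun_add i4) i5, integral_add ((i1.fun_add i2).fun_add i3) i4,
    integral_add (i1.fun_add i2) i3, integral_add i1 i2, integral_const_mul, integral_const_mul,
    integral_const_mul] at key
  simp only [V] at key
  simp only [pow_zero, pow_one, h1, h2] at key
  simp at key
  linarith

lemma aux_stdG (d : ℕ) : stdGaussianE d = stdGaussian (EuclideanSpace ℝ (Fin d)) := by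
  rw [← map_pi_eq_stdGaussian]; rfl

lemma aux_G (d : ℕ) : (∫ v, ‖v‖ ^ 2 ∂(stdGaussian (EuclideanSpace ℝ (Fin d))) = d) ∧
    (∫ v, ‖v‖ ^ 4 ∂(stdGaussian (EuclideanSpace ℝ (Fin d))) = d ^ 2 + 2 * d) := by
  have hL : MemLp (fun x : ℝ => x ^ 2) 2 (gaussianReal 0 1) := by
    rw [memLp_two_iff_integrable_sq (by fun_prop)]
    have h := (memLp_id_gaussianReal' (μ := 0) (v := 1) (4 : ℕ) (by simp)).integrable_norm_pow (by simp)
    refine h.congr (Eventually.of_forall fun x => ?_)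
    simp only [id, norm_eq_abs]
    rw [← pow_mul, show 2 * 2 = 4 from rfl, Even.pow_abs ⟨2, rfl⟩]
  have h2 : ∫ x, x ^ 2 ∂(gaussianReal 0 1) = 1 := by
    have := variance_fun_id_gaussianReal (μ := 0) (v := 1)
    rw [variance_eq_integral (by fun_prop)] at this
    simpa using this
  have hv : Var[fun x : ℝ => x ^ 2; gaussianReal 0 1] = 2 := by
    rw [variance_eq_sub hL, h2]
    have : ∫ x, ((fun x : ℝ => x ^ 2) ^ 2) x ∂(gaussianReal 0 1) = 3 := by
      rw [← aux_gauss_four]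
      congr 1; ext x; simp [← pow_mul]
    rw [this]; norm_num
  have hV := variance_sum_pi (ι := Fin d) (μ := fun _ => gaussianReal 0 1) (X := fun _ x => x ^ 2)
    (fun _ => hL)
  have hLs : MemLp (∑ i : Fin d, fun ω : Fin d → ℝ => ω i ^ 2) 2 (Measure.pi fun _ => gaussianReal 0 1) :=
    memLp_finsetSum' _ fun i _ => hL.comp_measurePreserving (measurePreserving_eval (fun _ : Fin d => gaussianReal 0 1) i)
  have hE : ∫ ω, (∑ i : Fin d, fun ω : Fin d → ℝ => ω i ^ 2) ω ∂(Measure.pi fun _ : Fin d => gaussianReal 0 1) = d := by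
    simp only [Finset.sum_apply]
    rw [integral_finsetSum]
    · have : ∀ i : Fin d, ∫ ω : Fin d → ℝ, ω i ^ 2 ∂(Measure.pi fun _ => gaussianReal 0 1) = 1 := by
        intro i
        rw [← h2]
        exact integral_comp_eval (μ := fun _ : Fin d => gaussianReal 0 1) (f := fun x : ℝ => x ^ 2) (by fun_prop)
      simp [this]
    · intro i _
      exact ((hL.comp_measurePreserving (measurePreserving_eval (fun _ : Fin d => gaussianReal 0 1) i))).integrable (by norm_num)
  rw [variance_eq_sub hLs, hE] at hV
  simp only [hv] at hV
  rw [← map_pi_eq_stdGaussian]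
  constructor
  · rw [integral_map (by fun_prop) (by fun_prop), ← hE]
    congr 1; ext ω
    simp [EuclideanSpace.real_norm_sq_eq]
  · rw [integral_map (by fun_prop) (by fun_prop)]
    have : ∀ ω : Fin d → ℝ, ‖WithLp.toLp 2 ω‖ ^ 4 = ((∑ i : Fin d, fun ω : Fin d → ℝ => ω i ^ 2) ^ 2) ω := by
      intro ω
      rw [show 4 = 2 * 2 from rfl, pow_mul, EuclideanSpace.real_norm_sq_eq]
      simp
    simp_rw [this]
    simp at hV
    simp
    linarith

section
variable {d : ℕ}

lemma aux_inner (hd : 2 ≤ d) (ν : Measure (EuclideanSpace ℝ (Fin d)))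
    [IsProbabilityMeasure ν] (hL : MemLp id 4 ν)
    (hinv : ∀ O : EuclideanSpace ℝ (Fin d) ≃ₗᵢ[ℝ] EuclideanSpace ℝ (Fin d), ν.map O = ν)
    (u : EuclideanSpace ℝ (Fin d)) :
    ∫ v, ⟪u, v⟫_ℝ ^ 2 ∂ν = (∫ v, ‖v‖ ^ 2 ∂ν) / d * ‖u‖ ^ 2 := by
  have hL2 : MemLp id 2 ν := hL.mono_exponent (by norm_num)
  have hI : ∀ u, Integrable (fun v => ⟪u, v⟫_ℝ ^ 2) ν := by
    intro u
    exact (MemLp.const_inner u hL2).integrable_sq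
  have hO : ∀ (O : EuclideanSpace ℝ (Fin d) ≃ₗᵢ[ℝ] EuclideanSpace ℝ (Fin d)) u,
      ∫ v, ⟪O u, v⟫_ℝ ^ 2 ∂ν = ∫ v, ⟪u, v⟫_ℝ ^ 2 ∂ν := by
    intro O u
    conv_lhs => rw [← hinv O]
    rw [integral_map (by fun_prop) (by fun_prop)]
    simp
  have hi : ∀ i, ∫ v, ⟪u, v⟫_ℝ ^ 2 ∂ν = ‖u‖ ^ 2 * ∫ v, ⟪EuclideanSpace.basisFun (Fin d) ℝ i, v⟫_ℝ ^ 2 ∂ν := by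
    intro i
    have := Submodule.reflection_sub (v := u) (w := ‖u‖ • EuclideanSpace.basisFun (Fin d) ℝ i)
      (by rw [norm_smul]; simp)
    rw [← hO _ u, this]
    simp_rw [real_inner_smul_left, mul_pow]
    rw [integral_const_mul]
  have hs : ∑ i, ∫ v, ⟪EuclideanSpace.basisFun (Fin d) ℝ i, v⟫_ℝ ^ 2 ∂ν = ∫ v, ‖v‖ ^ 2 ∂ν := by
    rw [← integral_finsetSum _ fun i _ => hI _]
    simp_rw [OrthonormalBasis.sum_sq_inner_right]
  have hd0 : (d : ℝ) ≠ 0 := by positivity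
  have : ∑ i : Fin d, ∫ v, ⟪u, v⟫_ℝ ^ 2 ∂ν = ‖u‖ ^ 2 * ∫ v, ‖v‖ ^ 2 ∂ν := by
    rw [← hs, Finset.mul_sum]
    exact Finset.sum_congr rfl fun i _ => hi i
  simp at this
  field_simp
  linarith

lemma aux_odd (ν : Measure (EuclideanSpace ℝ (Fin d)))
    (hinv : ∀ O : EuclideanSpace ℝ (Fin d) ≃ₗᵢ[ℝ] EuclideanSpace ℝ (Fin d), ν.map O = ν)
    (f : EuclideanSpace ℝ (Fin d) → ℝ) (hf : Continuous f) (hodd : ∀ v, f (-v) = - f v) :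
    ∫ v, f v ∂ν = 0 := by
  have : ∫ v, f v ∂ν = - ∫ v, f v ∂ν := by
    conv_lhs => rw [← hinv (LinearIsometryEquiv.neg ℝ)]
    rw [integral_map (by fun_prop) (by fun_prop)]
    simp [hodd, integral_neg]
  linarith

lemma aux_moments (hd : 2 ≤ d) (ν : Measure (EuclideanSpace ℝ (Fin d)))
    [IsProbabilityMeasure ν] (hL : MemLp id 4 ν)
    (hinv : ∀ O : EuclideanSpace ℝ (Fin d) ≃ₗᵢ[ℝ] EuclideanSpace ℝ (Fin d), ν.map O = ν)
    (s : ℝ) (u : EuclideanSpace ℝ (Fin d)) :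
    (∫ v, ‖u + s • v‖ ^ 2 ∂ν = ‖u‖ ^ 2 + s ^ 2 * ∫ v, ‖v‖ ^ 2 ∂ν) ∧
    (∫ v, ‖u + s • v‖ ^ 4 ∂ν = ‖u‖ ^ 4 + s ^ 4 * (∫ v, ‖v‖ ^ 4 ∂ν)
      + (2 + 4 / d) * s ^ 2 * (∫ v, ‖v‖ ^ 2 ∂ν) * ‖u‖ ^ 2) := by
  have hL2 : MemLp id 2 ν := hL.mono_exponent (by norm_num)
  have hL3 : MemLp id (3 : ℕ) ν := hL.mono_exponent (by norm_num)
  have hL4 : MemLp id (4 : ℕ) ν := hL.mono_exponent (by norm_num)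
  have j1 : Integrable (fun v => ⟪u, v⟫_ℝ) ν := (MemLp.const_inner u hL2).integrable (by norm_num)
  have j2 : Integrable (fun v => ‖v‖ ^ 2) ν := hL2.integrable_norm_pow (p := 2) (by norm_num)
  have j4 : Integrable (fun v => ‖v‖ ^ 4) ν := hL4.integrable_norm_pow (by norm_num)
  have j3 : Integrable (fun v => ‖v‖ ^ 3) ν := hL3.integrable_norm_pow (by norm_num)
  have ji : Integrable (fun v => ⟪u, v⟫_ℝ ^ 2) ν := (MemLp.const_inner u hL2).integrable_sq
  have jm : Integrable (fun v => ⟪u, v⟫_ℝ * ‖v‖ ^ 2) ν := by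
    refine (j3.const_mul ‖u‖).mono (by fun_prop) (Eventually.of_forall fun v => ?_)
    simp only [norm_mul, norm_pow, norm_norm]
    calc ‖⟪u, v⟫_ℝ‖ * ‖v‖ ^ 2 ≤ (‖u‖ * ‖v‖) * ‖v‖ ^ 2 := by
          gcongr; exact norm_inner_le_norm u v
      _ = _ := by ring
  have o1 : ∫ v, ⟪u, v⟫_ℝ ∂ν = 0 := aux_odd ν hinv _ (by fun_prop) (by simp)
  have o3 : ∫ v, ⟪u, v⟫_ℝ * ‖v‖ ^ 2 ∂ν = 0 := aux_odd ν hinv _ (by fun_prop) (by simp)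
  have hi := aux_inner hd ν hL hinv u
  have sq : ∀ v, ‖u + s • v‖ ^ 2 = ‖u‖ ^ 2 + (2 * s) * ⟪u, v⟫_ℝ + s ^ 2 * ‖v‖ ^ 2 := by
    intro v
    rw [norm_add_sq_real, real_inner_smul_right, norm_smul, mul_pow]
    simp; ring
  constructor
  · simp_rw [sq]
    rw [integral_add ((integrable_const _).fun_add (j1.const_mul _)) (j2.const_mul _),
      integral_add (integrable_const _) (j1.const_mul _), integral_const_mul, integral_const_mul, o1]
    simp
  · have q : ∀ v, ‖u + s • v‖ ^ 4 = ‖u‖ ^ 4 + (4 * s * ‖u‖ ^ 2) * ⟪u, v⟫_ℝ + (2 * s ^ 2 * ‖u‖ ^ 2) * ‖v‖ ^ 2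
        + (4 * s ^ 2) * ⟪u, v⟫_ℝ ^ 2 + (4 * s ^ 3) * (⟪u, v⟫_ℝ * ‖v‖ ^ 2) + s ^ 4 * ‖v‖ ^ 4 := by
      intro v
      rw [show ‖u + s • v‖ ^ 4 = (‖u + s • v‖ ^ 2) ^ 2 by ring, sq]; ring
    simp_rw [q]
    have k0 : Integrable (fun _ : EuclideanSpace ℝ (Fin d) => ‖u‖ ^ 4) ν := integrable_const _
    have k1 := j1.const_mul (4 * s * ‖u‖ ^ 2)
    have k2 := j2.const_mul (2 * s ^ 2 * ‖u‖ ^ 2)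
    have k3 := ji.const_mul (4 * s ^ 2)
    have k4 := jm.const_mul (4 * s ^ 3)
    have k5 := j4.const_mul (s ^ 4)
    rw [integral_add ((((k0.fun_add k1).fun_add k2).fun_add k3).fun_add k4) k5,
      integral_add (((k0.fun_add k1).fun_add k2).fun_add k3) k4,
      integral_add ((k0.fun_add k1).fun_add k2) k3, integral_add (k0.fun_add k1) k2, integral_add k0 k1]
    simp only [integral_const_mul, o1, o3, hi]
    simp
    ring

lemma aux_prod {Ω : Type*} [MeasurableSpace Ω] (P : Measure Ω) [IsProbabilityMeasure P]
    (U : Ω → EuclideanSpace ℝ (Fin d)) (hU : MemLp U 4 P)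
    (hd : 2 ≤ d) (ν : Measure (EuclideanSpace ℝ (Fin d)))
    [IsProbabilityMeasure ν] (hL : MemLp id 4 ν)
    (hinv : ∀ O : EuclideanSpace ℝ (Fin d) ≃ₗᵢ[ℝ] EuclideanSpace ℝ (Fin d), ν.map O = ν)
    (s : ℝ) :
    MemLp (fun p : Ω × EuclideanSpace ℝ (Fin d) => U p.1 + s • p.2) 4 (P.prod ν) ∧
    (∫ p, ‖U p.1 + s • p.2‖ ^ 2 ∂(P.prod ν) = (∫ p, ‖U p‖ ^ 2 ∂P) + s ^ 2 * ∫ v, ‖v‖ ^ 2 ∂ν) ∧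
    (∫ p, ‖U p.1 + s • p.2‖ ^ 4 ∂(P.prod ν) = (∫ p, ‖U p‖ ^ 4 ∂P) + s ^ 4 * (∫ v, ‖v‖ ^ 4 ∂ν)
      + (2 + 4 / d) * s ^ 2 * (∫ v, ‖v‖ ^ 2 ∂ν) * (∫ p, ‖U p‖ ^ 2 ∂P)) := by
  have hM : MemLp (fun p : Ω × EuclideanSpace ℝ (Fin d) => U p.1 + s • p.2) 4 (P.prod ν) :=
    (hU.comp_measurePreserving measurePreserving_fst).add
      ((hL.comp_measurePreserving measurePreserving_snd).const_smul s)
  have hM2 := hM.mono_exponent (p := 2) (by norm_num)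
  have hM4 := hM.mono_exponent (p := (4 : ℕ)) (by norm_num)
  have hU2 := hU.mono_exponent (p := 2) (by norm_num)
  have hU4 := hU.mono_exponent (p := (4 : ℕ)) (by norm_num)
  have j2 : Integrable (fun v => ‖U v‖ ^ 2) P := hU2.integrable_norm_pow (p := 2) (by norm_num)
  have j4 : Integrable (fun v => ‖U v‖ ^ 4) P := hU4.integrable_norm_pow (by norm_num)
  have I2 : Integrable (fun p : Ω × EuclideanSpace ℝ (Fin d) => ‖U p.1 + s • p.2‖ ^ 2) (P.prod ν) :=
    hM2.integrable_norm_pow (p := 2) (by norm_num)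
  have I4 : Integrable (fun p : Ω × EuclideanSpace ℝ (Fin d) => ‖U p.1 + s • p.2‖ ^ 4) (P.prod ν) :=
    hM4.integrable_norm_pow (by norm_num)
  refine ⟨hM, ?_, ?_⟩
  · rw [integral_prod _ I2]
    simp only [fun u => (aux_moments hd ν hL hinv s u).1]
    rw [integral_add j2 (integrable_const _)]
    simp
  · rw [integral_prod _ I4]
    simp only [fun u => (aux_moments hd ν hL hinv s u).2]
    rw [integral_add (j4.fun_add (integrable_const _)) (j2.const_mul _),
      integral_add j4 (integrable_const _)]
    simp
    rw [integral_const_mul]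

lemma aux_pi (hd : 2 ≤ d) (X : EuclideanSpace ℝ (Fin d))
    (ν : Measure (EuclideanSpace ℝ (Fin d)))
    [IsProbabilityMeasure ν] (hL : MemLp id 4 ν)
    (hinv : ∀ O : EuclideanSpace ℝ (Fin d) ≃ₗᵢ[ℝ] EuclideanSpace ℝ (Fin d), ν.map O = ν)
    (h2 : ∫ v, ‖v‖ ^ 2 ∂ν = 1) (h4 : ∫ v, ‖v‖ ^ 4 ∂ν = 1) (k : ℕ) :
    MemLp (fun c : Fin k → EuclideanSpace ℝ (Fin d) => X + ∑ i, c i) 4 (Measure.pi fun _ => ν) ∧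
    (∫ c : Fin k → EuclideanSpace ℝ (Fin d), ‖X + ∑ i, c i‖ ^ 2 ∂(Measure.pi fun _ => ν)
      = ‖X‖ ^ 2 + k) ∧
    (∫ c : Fin k → EuclideanSpace ℝ (Fin d), ‖X + ∑ i, c i‖ ^ 4 ∂(Measure.pi fun _ => ν)
      = (‖X‖ ^ 2 + k) ^ 2 + 4 * k * ‖X‖ ^ 2 / d + 2 * k * (k - 1) / d) := by
  induction k with
  | zero =>
    refine ⟨by simpa using memLp_const X, by simp, ?_⟩
    simp; ring
  | succ k ih =>
    obtain ⟨i0, i2, i4⟩ := ih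
    obtain ⟨a0, a2, a4⟩ := aux_prod _ _ i0 hd ν hL hinv 1
    have mp := (measurePreserving_piFinSuccAbove (fun _ : Fin (k + 1) => ν) 0)
    have mp2 := (Measure.measurePreserving_swap (μ := ν)
      (ν := Measure.pi fun _ : Fin k => ν)).comp mp
    have hfun : ∀ c : Fin (k + 1) → EuclideanSpace ℝ (Fin d), X + ∑ i, c i =
        (fun p : (Fin k → EuclideanSpace ℝ (Fin d)) × EuclideanSpace ℝ (Fin d) =>
          X + ∑ i, p.1 i + (1 : ℝ) • p.2)
          ((Prod.swap ∘ MeasurableEquiv.piFinSuccAbove (fun _ => EuclideanSpace ℝ (Fin d)) 0) c) := by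
      intro c
      simp [Fin.sum_univ_succ, Fin.removeNth]
      abel
    have hme : MeasurableEmbedding (Prod.swap ∘ MeasurableEquiv.piFinSuccAbove
        (fun _ : Fin (k + 1) => EuclideanSpace ℝ (Fin d)) 0) :=
      MeasurableEquiv.prodComm.measurableEmbedding.comp (MeasurableEquiv.measurableEmbedding _)
    refine ⟨?_, ?_, ?_⟩
    · simp_rw [hfun]
      exact a0.comp_measurePreserving mp2
    · simp_rw [hfun]
      rw [mp2.integral_comp hme (fun p : (Fin k → EuclideanSpace ℝ (Fin d)) × EuclideanSpace ℝ (Fin d) => ‖X + ∑ i, p.1 i + (1 : ℝ) • p.2‖ ^ 2), a2, i2, h2]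
      push_cast; ring
    · simp_rw [hfun]
      rw [mp2.integral_comp hme (fun p : (Fin k → EuclideanSpace ℝ (Fin d)) × EuclideanSpace ℝ (Fin d) => ‖X + ∑ i, p.1 i + (1 : ℝ) • p.2‖ ^ 4), a4, i2, i4, h2, h4]
      push_cast; ring

end

/-- Under the one-shot random-canary setup (the `c_i` i.i.d. uniform on
the sphere `S^{d-1}`, `Z ∼ N(0, I_d)` independent, `ρ = X + ∑ c_i + σZ`),
`Var[‖ρ‖²] = 4k‖X‖²/d + 4σ²‖X‖² + 2k(k-1)/d + 4kσ² + 2σ⁴d`. -/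
theorem variance_sq_norm_rho (d k : ℕ) (hd : 2 ≤ d) (hk : 1 ≤ k)
    (X : EuclideanSpace ℝ (Fin d)) (σ : ℝ) (hσ : 0 < σ)
    (μs : Measure (EuclideanSpace ℝ (Fin d))) [IsProbabilityMeasure μs]
    (hsphere : μs (Metric.sphere (0 : EuclideanSpace ℝ (Fin d)) 1) = 1)
    (hinv : ∀ O : EuclideanSpace ℝ (Fin d) ≃ₗᵢ[ℝ] EuclideanSpace ℝ (Fin d),
      μs.map O = μs) :
    variance (fun ω => ‖rhoF d k X σ ω‖ ^ 2) (canaryP d k μs) =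
      4 * k * ‖X‖ ^ 2 / d + 4 * σ ^ 2 * ‖X‖ ^ 2 + 2 * k * (k - 1) / d
        + 4 * k * σ ^ 2 + 2 * σ ^ 4 * d := by

  have hae : ∀ᵐ v ∂μs, ‖v‖ = 1 := by
    have : ∀ᵐ v ∂μs, v ∈ Metric.sphere (0 : EuclideanSpace ℝ (Fin d)) 1 :=
      (mem_ae_iff_prob_eq_one Metric.isClosed_sphere.measurableSet).2 hsphere
    filter_upwards [this] with v hv
    simpa using hv
  have hL : MemLp id 4 μs := by
    refine MemLp.of_bound (by fun_prop) 1 ?_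
    filter_upwards [hae] with v hv
    simp [hv]
  have hn : ∀ n : ℕ, ∫ v, ‖v‖ ^ n ∂μs = 1 := by
    intro n
    have : ∫ v, ‖v‖ ^ n ∂μs = ∫ v, (1 : ℝ) ∂μs := by
      apply integral_congr_ae
      filter_upwards [hae] with v hv
      simp [hv]
    simp [this]
  obtain ⟨p0, p2, p4⟩ := aux_pi hd X μs hL hinv (hn 2) (hn 4) k
  have hG : MemLp id 4 (stdGaussian (EuclideanSpace ℝ (Fin d))) :=
    IsGaussian.memLp_id _ _ (by simp)
  obtain ⟨q0, q2, q4⟩ := aux_prod _ _ p0 hd _ hG (fun O => stdGaussian_map O) σ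
  have hd0 : (d : ℝ) ≠ 0 := by positivity
  unfold canaryP rhoF
  rw [aux_stdG]
  have hM : MemLp (fun ω : (Fin k → EuclideanSpace ℝ (Fin d)) × EuclideanSpace ℝ (Fin d) =>
      ‖X + (∑ i, ω.1 i) + σ • ω.2‖ ^ 2) 2
      ((Measure.pi fun _ : Fin k => μs).prod (stdGaussian (EuclideanSpace ℝ (Fin d)))) := by
    refine (memLp_two_iff_integrable_sq (q0.1.norm.pow 2)).2 ?_
    have := (q0.mono_exponent (p := (4 : ℕ)) (by norm_num)).integrable_norm_pow (by norm_num)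
    refine this.congr (Eventually.of_forall fun ω => ?_)
    simp only [Pi.pow_apply, ← pow_mul]
  rw [variance_eq_sub hM, q2]
  simp only [Pi.pow_apply, ← pow_mul]
  rw [show 2 * 2 = 4 from rfl, q4, p2, p4, (aux_G d).1, (aux_G d).2]
  field_simp
  ring
end

section
/- Under the asymptotic one-shot random-canary setup, ‖ρ_d‖/√d converges in probability to σ as d → ∞ (equivalently, ‖ρ_d‖²/d converges in probability to σ²). -/
open MeasureTheory ProbabilityTheory Real Filter
open scoped InnerProductSpace Topology ENNReal

/-- The cosine statistic `g_i = ⟪c_i, ρ⟫ / ‖ρ‖` of the `i`-th canary. -/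
noncomputable def cosStat (d k : ℕ) (X : EuclideanSpace ℝ (Fin d)) (σ : ℝ)
    (ω : (Fin k → EuclideanSpace ℝ (Fin d)) × EuclideanSpace ℝ (Fin d)) (i : Fin k) : ℝ :=
  ⟪ω.1 i, rhoF d k X σ ω⟫_ℝ / ‖rhoF d k X σ ω‖

/-- The empirical mean `μ̂ = (1/k) ∑ᵢ g_i` of the canary cosines. -/
noncomputable def muHat (d k : ℕ) (X : EuclideanSpace ℝ (Fin d)) (σ : ℝ)
    (ω : (Fin k → EuclideanSpace ℝ (Fin d)) × EuclideanSpace ℝ (Fin d)) : ℝ :=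
  (1 / k : ℝ) * ∑ i, cosStat d k X σ ω i

/-- The empirical variance `σ̂² = (1/k) ∑ᵢ (g_i - μ̂)²` of the canary cosines. -/
noncomputable def sigmaHatSq (d k : ℕ) (X : EuclideanSpace ℝ (Fin d)) (σ : ℝ)
    (ω : (Fin k → EuclideanSpace ℝ (Fin d)) × EuclideanSpace ℝ (Fin d)) : ℝ :=
  (1 / k : ℝ) * ∑ i, (cosStat d k X σ ω i - muHat d k X σ ω) ^ 2

lemma canary_sum_bound (d k : ℕ) (μ : Measure (EuclideanSpace ℝ (Fin d)))
    [IsProbabilityMeasure μ]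
    (hs : μ (Metric.sphere (0 : EuclideanSpace ℝ (Fin d)) 1) = 1)
    (hneg : μ.map (LinearIsometryEquiv.neg ℝ : EuclideanSpace ℝ (Fin d) ≃ₗᵢ[ℝ] _) = μ)
    (δ : ℝ) (hδ : 0 < δ) :
    (Measure.pi fun _ : Fin k => μ) {c | δ ≤ ‖∑ i, c i‖ ^ 2} ≤ ENNReal.ofReal (k / δ) := by
  have hae : ∀ᵐ x ∂μ, ‖x‖ = 1 := by
    have h : ∀ᵐ x ∂μ, x ∈ Metric.sphere (0 : EuclideanSpace ℝ (Fin d)) 1 :=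
      (prob_compl_eq_zero_iff Metric.isClosed_sphere.measurableSet).2 hs
    filter_upwards [h] with x hx
    simpa using hx
  have hL : ∀ a : Fin d, MemLp (fun x : EuclideanSpace ℝ (Fin d) => x a) 2 μ := by
    intro a
    refine MemLp.of_bound (Measurable.aestronglyMeasurable (by fun_prop)) 1 ?_
    filter_upwards [hae] with x hx
    exact (PiLp.norm_apply_le x a).trans hx.le
  have hmean : ∀ a : Fin d, ∫ x, x a ∂μ = 0 := by
    intro a
    have h1 : ∫ x, x a ∂μ = ∫ x, (-x) a ∂μ := by
      conv_lhs => rw [← hneg]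
      rw [integral_map (by fun_prop) (Measurable.aestronglyMeasurable (by fun_prop))]
      rfl
    have h2 : ∫ x : EuclideanSpace ℝ (Fin d), (-x) a ∂μ = - ∫ x, x a ∂μ := by
      rw [← integral_neg]; rfl
    linarith
  have hLi : ∀ (a : Fin d) (i : Fin k), MemLp
      (fun c : Fin k → EuclideanSpace ℝ (Fin d) => c i a) 2 (Measure.pi fun _ => μ) := by
    intro a i
    exact (hL a).comp_measurePreserving (measurePreserving_eval (fun _ : Fin k => μ) i)
  have hLS : ∀ a : Fin d, MemLp
      (∑ i : Fin k, fun c : Fin k → EuclideanSpace ℝ (Fin d) => c i a) 2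
        (Measure.pi fun _ => μ) := by
    intro a
    exact memLp_finsetSum' _ (fun i _ => hLi a i)
  have hSint : ∀ a : Fin d, ∫ c, (∑ i : Fin k, fun c : Fin k → EuclideanSpace ℝ (Fin d) => c i a) c
      ∂(Measure.pi fun _ => μ) = 0 := by
    intro a
    simp only [Finset.sum_apply]
    rw [integral_finsetSum _ (fun i _ => (hLi a i).integrable one_le_two)]
    refine Finset.sum_eq_zero fun i _ => ?_
    rw [integral_comp_eval (μ := fun _ : Fin k => μ)
      (f := fun x : EuclideanSpace ℝ (Fin d) => x a) (hL a).1]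
    exact hmean a
  have hvar : ∀ a : Fin d,
      ∫ c, ((∑ i : Fin k, fun c : Fin k → EuclideanSpace ℝ (Fin d) => c i a) c) ^ 2
      ∂(Measure.pi fun _ => μ) = k * ∫ x, (x a) ^ 2 ∂μ := by
    intro a
    rw [← variance_of_integral_eq_zero (hLS a).1.aemeasurable (hSint a),
      variance_sum_pi (μ := fun _ : Fin k => μ)
        (X := fun _ (x : EuclideanSpace ℝ (Fin d)) => x a) (fun _ => hL a),
      variance_of_integral_eq_zero (hL a).1.aemeasurable (hmean a)]
    simp
  have hnorm : ∀ c : Fin k → EuclideanSpace ℝ (Fin d), ‖∑ i, c i‖ ^ 2 =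
      ∑ a, ((∑ i : Fin k, fun c : Fin k → EuclideanSpace ℝ (Fin d) => c i a) c) ^ 2 := by
    intro c
    rw [EuclideanSpace.real_norm_sq_eq]
    simp
  have hint : Integrable (fun c : Fin k → EuclideanSpace ℝ (Fin d) => ‖∑ i, c i‖ ^ 2)
      (Measure.pi fun _ => μ) := by
    simp_rw [hnorm]
    exact integrable_finsetSum _ (fun a _ => (hLS a).integrable_sq)
  have hI : ∫ c : Fin k → EuclideanSpace ℝ (Fin d), ‖∑ i, c i‖ ^ 2 ∂(Measure.pi fun _ => μ)
      = k := by
    simp_rw [hnorm]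
    rw [integral_finsetSum _ (fun a _ => (hLS a).integrable_sq)]
    simp_rw [hvar]
    rw [← Finset.mul_sum, ← integral_finsetSum _ (fun a _ => (hL a).integrable_sq)]
    have : ∫ x : EuclideanSpace ℝ (Fin d), ∑ a, (x a) ^ 2 ∂μ = ∫ x, (1 : ℝ) ∂μ := by
      refine integral_congr_ae ?_
      filter_upwards [hae] with x hx
      rw [← EuclideanSpace.real_norm_sq_eq, hx]; norm_num
    rw [this]; simp
  have hM := mul_meas_ge_le_integral_of_nonneg (μ := Measure.pi fun _ : Fin k => μ)
    (Eventually.of_forall fun c => by positivity) hint δ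
  rw [hI] at hM
  rw [← ofReal_measureReal]
  refine ENNReal.ofReal_le_ofReal ?_
  rw [le_div_iff₀ hδ]; linarith

lemma gauss_bound (d : ℕ) (hd : 1 ≤ d) (δ : ℝ) (hδ : 0 < δ) :
    stdGaussianE d {z | δ ≤ |‖z‖ / Real.sqrt d - 1|} ≤
      ENNReal.ofReal (Var[fun x : ℝ => x ^ 2; gaussianReal 0 1] / δ ^ 2 / d) := by
  have hd0 : (0 : ℝ) < d := by exact_mod_cast hd
  have hmeas : Measurable (EuclideanSpace.equiv (Fin d) ℝ).symm :=
    (EuclideanSpace.equiv (Fin d) ℝ).symm.continuous.measurable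
  have hset : MeasurableSet {z : EuclideanSpace ℝ (Fin d) | δ ≤ |‖z‖ / Real.sqrt d - 1|} :=
    measurableSet_le (by fun_prop) (by fun_prop)
  have hL : MemLp (fun x : ℝ => x ^ 2) 2 (gaussianReal 0 1) := by
    have h4 : MemLp (id : ℝ → ℝ) 4 (gaussianReal 0 1) := memLp_id_gaussianReal' 4 (by simp)
    have := h4.mul (r := 2) h4 (hpqr := ⟨by
      rw [← two_mul]
      rw [show (4 : ℝ≥0∞) = 2 * 2 by norm_num, ENNReal.mul_inv (by simp) (by simp), ← mul_assoc,
        ENNReal.mul_inv_cancel (by simp) (by simp), one_mul]⟩)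
    refine this.ae_eq (Eventually.of_forall fun x => ?_)
    simp [sq]
  have h1 : ∫ x, x ^ 2 ∂(gaussianReal 0 1) = 1 := by
    have h := variance_of_integral_eq_zero (X := (id : ℝ → ℝ)) (μ := gaussianReal 0 1)
      (by fun_prop) (by simp)
    rw [variance_id_gaussianReal] at h
    simpa using h.symm
  have hLi : ∀ i : Fin d, MemLp (fun z : Fin d → ℝ => (z i) ^ 2) 2
      (Measure.pi fun _ : Fin d => gaussianReal 0 1) := fun i =>
    hL.comp_measurePreserving (measurePreserving_eval (fun _ : Fin d => gaussianReal 0 1) i)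
  have hLS : MemLp (∑ i : Fin d, fun z : Fin d → ℝ => (z i) ^ 2) 2
      (Measure.pi fun _ : Fin d => gaussianReal 0 1) := memLp_finsetSum' _ (fun i _ => hLi i)
  have hE : ∫ z, (∑ i : Fin d, fun z : Fin d → ℝ => (z i) ^ 2) z
      ∂(Measure.pi fun _ : Fin d => gaussianReal 0 1) = d := by
    simp only [Finset.sum_apply]
    rw [integral_finsetSum _ (fun i _ => (hLi i).integrable one_le_two)]
    have : ∀ i : Fin d, ∫ z : Fin d → ℝ, (z i) ^ 2
        ∂(Measure.pi fun _ : Fin d => gaussianReal 0 1) = 1 := by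
      intro i
      rw [integral_comp_eval (μ := fun _ : Fin d => gaussianReal 0 1)
        (f := fun x : ℝ => x ^ 2) hL.1]
      exact h1
    simp [this]
  have hV := variance_sum_pi (μ := fun _ : Fin d => gaussianReal 0 1)
        (X := fun _ (x : ℝ) => x ^ 2) (fun _ => hL)
  have hC := meas_ge_le_variance_div_sq hLS (c := δ * d) (by positivity)
  rw [hE, hV] at hC
  rw [stdGaussianE, Measure.map_apply hmeas hset]
  refine (measure_mono ?_).trans (hC.trans (ENNReal.ofReal_le_ofReal (le_of_eq ?_)))
  · intro z hz
    simp only [Set.mem_preimage, Set.mem_setOf_eq] at hz ⊢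
    set w := (EuclideanSpace.equiv (Fin d) ℝ).symm z with hw
    have hn : (∑ i : Fin d, fun z : Fin d → ℝ => (z i) ^ 2) z = ‖w‖ ^ 2 := by
      rw [EuclideanSpace.real_norm_sq_eq]
      simp [hw]
    rw [hn]
    set t := ‖w‖ / Real.sqrt d with ht
    have ht0 : 0 ≤ t := by positivity
    have hwt : ‖w‖ ^ 2 = t ^ 2 * d := by
      rw [ht, div_pow, Real.sq_sqrt hd0.le]; field_simp
    rw [hwt, show t ^ 2 * d - d = (t - 1) * (t + 1) * d by ring, abs_mul, abs_mul,
      abs_of_pos hd0, abs_of_pos (by linarith : 0 < t + 1)]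
    gcongr
    nlinarith [abs_nonneg (t - 1)]
  · simp; field_simp

instance stdGaussianE_prob (d : ℕ) : IsProbabilityMeasure (stdGaussianE d) :=
  Measure.isProbabilityMeasure_map
    ((EuclideanSpace.equiv (Fin d) ℝ).symm.continuous.measurable).aemeasurable


/-- Under the asymptotic one-shot random-canary setup
(`‖X_d‖ = o(√d)`, `k = o(d)`, `k = ω(1)`, canaries i.i.d. uniform on the sphere,
`Z_d ∼ N(0, I_d)` independent, `ρ_d = X_d + ∑ᵢ c_{di} + σ Z_d`),
`‖ρ_d‖ / √d` converges in probability to `σ` as `d → ∞`. -/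
theorem norm_rho_tendsto_in_probability
    (X : ∀ d : ℕ, EuclideanSpace ℝ (Fin d))
    (hX : (fun d : ℕ => ‖X d‖) =o[atTop] fun d : ℕ => Real.sqrt d)
    (k : ℕ → ℕ)
    (hk₁ : Tendsto (fun d : ℕ => (k d : ℝ)) atTop atTop)
    (hk₂ : Tendsto (fun d : ℕ => (k d : ℝ) / d) atTop (𝓝 0))
    (σ : ℝ) (hσ : 0 < σ)
    (μs : ∀ d : ℕ, Measure (EuclideanSpace ℝ (Fin d)))
    (hprob : ∀ d, 1 ≤ d → IsProbabilityMeasure (μs d))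
    (hsphere : ∀ d, 1 ≤ d → μs d (Metric.sphere (0 : EuclideanSpace ℝ (Fin d)) 1) = 1)
    (hinv : ∀ d, 1 ≤ d →
      ∀ O : EuclideanSpace ℝ (Fin d) ≃ₗᵢ[ℝ] EuclideanSpace ℝ (Fin d),
        (μs d).map O = μs d) :
    ∀ ε : ℝ, 0 < ε →
      Tendsto (fun d : ℕ =>
          canaryP d (k d) (μs d)
            {ω | ε ≤ |‖rhoF d (k d) (X d) σ ω‖ / Real.sqrt d - σ|})
        atTop (𝓝 0) := by
  intro ε hε
  set V := Var[fun x : ℝ => x ^ 2; gaussianReal 0 1]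
  have hlim : Tendsto (fun d : ℕ => ENNReal.ofReal (k d / ((ε / 3) ^ 2 * d)) +
      ENNReal.ofReal (V / (ε / 3 / σ) ^ 2 / d)) atTop (𝓝 0) := by
    have h1 : Tendsto (fun d : ℕ => (k d : ℝ) / ((ε / 3) ^ 2 * d)) atTop (𝓝 0) := by
      have := hk₂.const_mul (((ε / 3) ^ 2)⁻¹)
      rw [mul_zero] at this
      refine this.congr fun d => ?_
      simp only [div_eq_mul_inv, mul_inv]; ring
    have h2 : Tendsto (fun d : ℕ => V / (ε / 3 / σ) ^ 2 / (d : ℝ)) atTop (𝓝 0) :=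
      tendsto_const_div_atTop_nhds_zero_nat _
    have := (ENNReal.tendsto_ofReal h1).add (ENNReal.tendsto_ofReal h2)
    simpa using this
  refine tendsto_of_tendsto_of_tendsto_of_le_of_le' tendsto_const_nhds hlim
    (Eventually.of_forall fun _ => zero_le) ?_
  have hXe := hX.bound (show (0 : ℝ) < ε / 6 by positivity)
  filter_upwards [hXe, eventually_ge_atTop 1] with d hXd hd
  have := hprob d hd
  have hd0 : (0 : ℝ) < d := by exact_mod_cast hd
  have hsd : 0 < Real.sqrt d := Real.sqrt_pos.2 hd0
  have hA := canary_sum_bound d (k d) (μs d) (hsphere d hd) (hinv d hd _)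
    ((ε / 3) ^ 2 * d) (by positivity)
  have hB := gauss_bound d hd (ε / 3 / σ) (by positivity)
  set A := {c : Fin (k d) → EuclideanSpace ℝ (Fin d) | (ε / 3) ^ 2 * d ≤ ‖∑ i, c i‖ ^ 2}
  set B := {z : EuclideanSpace ℝ (Fin d) | ε / 3 / σ ≤ |‖z‖ / Real.sqrt d - 1|}
  have hsub : {ω | ε ≤ |‖rhoF d (k d) (X d) σ ω‖ / Real.sqrt d - σ|} ⊆
      A ×ˢ Set.univ ∪ Set.univ ×ˢ B := by
    rintro ⟨c, z⟩ h
    by_contra hcon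
    simp only [Set.mem_union, Set.mem_prod, Set.mem_univ, and_true, true_and, not_or, A, B,
      Set.mem_setOf_eq, not_le] at hcon
    obtain ⟨hc, hz⟩ := hcon
    simp only [Set.mem_setOf_eq, rhoF] at h
    have hc' : ‖∑ i, c i‖ < ε / 3 * Real.sqrt d := by
      refine lt_of_pow_lt_pow_left₀ 2 (by positivity) ?_
      rwa [mul_pow, Real.sq_sqrt hd0.le]
    rw [Real.norm_of_nonneg (norm_nonneg _), Real.norm_of_nonneg hsd.le] at hXd
    have hz' : |σ * ‖z‖ - σ * Real.sqrt d| < ε / 3 * Real.sqrt d := by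
      rw [show σ * ‖z‖ - σ * Real.sqrt d = (‖z‖ / Real.sqrt d - 1) * (σ * Real.sqrt d) by
        field_simp, abs_mul, abs_of_pos (by positivity : 0 < σ * Real.sqrt d)]
      rw [lt_div_iff₀ hσ] at hz
      nlinarith
    have htri : |‖X d + ∑ i, c i + σ • z‖ - σ * ‖z‖| ≤ ‖X d‖ + ‖∑ i, c i‖ := by
      have h1 := abs_norm_sub_norm_le (X d + ∑ i, c i + σ • z) (σ • z)
      rw [add_sub_cancel_right, norm_smul, Real.norm_of_nonneg hσ.le] at h1
      exact h1.trans (norm_add_le _ _)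
    rw [show ‖X d + ∑ i, c i + σ • z‖ / Real.sqrt d - σ =
      (‖X d + ∑ i, c i + σ • z‖ - σ * Real.sqrt d) / Real.sqrt d by field_simp,
      abs_div, abs_of_pos hsd, le_div_iff₀ hsd] at h
    have h3 := abs_sub_le ‖X d + ∑ i, c i + σ • z‖ (σ * ‖z‖) (σ * Real.sqrt d)
    nlinarith
  calc canaryP d (k d) (μs d) _ ≤ canaryP d (k d) (μs d) (A ×ˢ Set.univ ∪ Set.univ ×ˢ B) :=
        measure_mono hsub
    _ ≤ canaryP d (k d) (μs d) (A ×ˢ Set.univ) + canaryP d (k d) (μs d) (Set.univ ×ˢ B) :=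
        measure_union_le _ _
    _ ≤ _ := by
        rw [canaryP, Measure.prod_prod, Measure.prod_prod, measure_univ, measure_univ, mul_one,
          one_mul]
        exact add_le_add hA hB
end

section
/- Under the asymptotic one-shot random-canary setup, the average canary–output inner product (1/k) Σ_{i=1}^k ⟨c_{di}, ρ_d⟩ converges in probability to 1 as d → ∞. -/
open MeasureTheory ProbabilityTheory Real Filter
open scoped InnerProductSpace Topology ENNReal

section helpers

variable {d : ℕ} {μ : Measure (EuclideanSpace ℝ (Fin d))}

lemma aux_ae [IsProbabilityMeasure μ]
    (hs : μ (Metric.sphere (0 : EuclideanSpace ℝ (Fin d)) 1) = 1) : ∀ᵐ x ∂μ, ‖x‖ = 1 := by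
  have h := (prob_compl_eq_zero_iff (μ := μ) (Metric.isClosed_sphere (x := (0 : EuclideanSpace ℝ (Fin d))) (ε := 1)).measurableSet).2 hs
  rw [ae_iff]
  convert h using 2
  ext x
  simp

lemma aux_int_inner [IsProbabilityMeasure μ] (hae : ∀ᵐ x ∂μ, ‖x‖ = 1)
    (v : EuclideanSpace ℝ (Fin d)) : Integrable (fun x => ⟪x, v⟫_ℝ) μ := by
  refine Integrable.of_bound (by fun_prop) ‖v‖ ?_
  filter_upwards [hae] with x hx
  have := norm_inner_le_norm (𝕜 := ℝ) x v
  rwa [hx, one_mul] at this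

lemma aux_int_sq [IsProbabilityMeasure μ] (hae : ∀ᵐ x ∂μ, ‖x‖ = 1)
    (v : EuclideanSpace ℝ (Fin d)) : Integrable (fun x => ⟪x, v⟫_ℝ ^ 2) μ := by
  refine Integrable.of_bound (by fun_prop) (‖v‖ ^ 2) ?_
  filter_upwards [hae] with x hx
  have := norm_inner_le_norm (𝕜 := ℝ) x v
  rw [hx, one_mul] at this
  rw [norm_pow]
  gcongr

lemma aux_mean (hinv : ∀ O : EuclideanSpace ℝ (Fin d) ≃ₗᵢ[ℝ] EuclideanSpace ℝ (Fin d),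
        μ.map O = μ) (v : EuclideanSpace ℝ (Fin d)) : ∫ x, ⟪x, v⟫_ℝ ∂μ = 0 := by
  have h : ∫ x, ⟪x, v⟫_ℝ ∂(μ.map (LinearIsometryEquiv.neg ℝ : EuclideanSpace ℝ (Fin d) ≃ₗᵢ[ℝ] _))
      = ∫ x, ⟪x, v⟫_ℝ ∂μ := by rw [hinv]
  rw [integral_map (by fun_prop) (by fun_prop)] at h
  simp only [LinearIsometryEquiv.coe_neg, inner_neg_left, integral_neg] at h
  linarith

lemma aux_rot (hinv : ∀ O : EuclideanSpace ℝ (Fin d) ≃ₗᵢ[ℝ] EuclideanSpace ℝ (Fin d),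
        μ.map O = μ) (v w : EuclideanSpace ℝ (Fin d)) (hvw : ‖v‖ = ‖w‖) :
    ∫ x, ⟪x, v⟫_ℝ ^ 2 ∂μ = ∫ x, ⟪x, w⟫_ℝ ^ 2 ∂μ := by
  set R := Submodule.reflection (ℝ ∙ (v - w))ᗮ with hR
  have hRv : R v = w := Submodule.reflection_sub hvw
  have h : ∫ x, ⟪x, w⟫_ℝ ^ 2 ∂(μ.map R) = ∫ x, ⟪x, w⟫_ℝ ^ 2 ∂μ := by rw [hinv]
  rw [integral_map (by fun_prop) (by fun_prop)] at h
  rw [← h]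
  congr 1
  ext x
  rw [← hRv, LinearIsometryEquiv.inner_map_map]

lemma aux_second [IsProbabilityMeasure μ] (hd : 1 ≤ d) (hae : ∀ᵐ x ∂μ, ‖x‖ = 1)
    (hinv : ∀ O : EuclideanSpace ℝ (Fin d) ≃ₗᵢ[ℝ] EuclideanSpace ℝ (Fin d),
        μ.map O = μ) (v : EuclideanSpace ℝ (Fin d)) :
    ∫ x, ⟪x, v⟫_ℝ ^ 2 ∂μ = ‖v‖ ^ 2 / d := by
  have hi : ∀ i : Fin d, ∫ x, ⟪x, v⟫_ℝ ^ 2 ∂μ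
      = ‖v‖ ^ 2 * ∫ x, (x i) ^ 2 ∂μ := by
    intro i
    rw [aux_rot hinv v (‖v‖ • EuclideanSpace.single i (1 : ℝ)) (by simp [norm_smul]),
      ← integral_const_mul]
    congr 1
    ext x
    simp [inner_smul_right, mul_pow, EuclideanSpace.inner_single_right]
  have hint : ∀ i : Fin d, Integrable (fun x : EuclideanSpace ℝ (Fin d) => (x i) ^ 2) μ := by
    intro i
    have := aux_int_sq hae (EuclideanSpace.single i (1 : ℝ))
    simpa [EuclideanSpace.inner_single_right] using this
  have hsum : ∑ i : Fin d, ∫ x, (x i) ^ 2 ∂μ = 1 := by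
    rw [← integral_finsetSum _ (fun i _ => hint i)]
    have : ∀ᵐ x ∂μ, ∑ i : Fin d, (x i) ^ 2 = (1 : ℝ) := by
      filter_upwards [hae] with x hx
      rw [← EuclideanSpace.real_norm_sq_eq, hx, one_pow]
    rw [integral_congr_ae this]
    simp
  have h2 : ∑ i : Fin d, ∫ x, ⟪x, v⟫_ℝ ^ 2 ∂μ = ‖v‖ ^ 2 := by
    rw [Finset.sum_congr rfl (fun i _ => hi i), ← Finset.mul_sum, hsum, mul_one]
  rw [Finset.sum_const, Finset.card_univ, Fintype.card_fin, nsmul_eq_mul] at h2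
  have : (0 : ℝ) < d := by exact_mod_cast hd
  field_simp
  linarith

lemma aux_A [IsProbabilityMeasure μ] (hd : 1 ≤ d) (hae : ∀ᵐ x ∂μ, ‖x‖ = 1)
    (hinv : ∀ O : EuclideanSpace ℝ (Fin d) ≃ₗᵢ[ℝ] EuclideanSpace ℝ (Fin d),
        μ.map O = μ) (a : ℝ) (v : EuclideanSpace ℝ (Fin d)) :
    ∫⁻ x, ENNReal.ofReal ((a + ⟪x, v⟫_ℝ) ^ 2) ∂μ
      = ENNReal.ofReal (a ^ 2) + ENNReal.ofReal (‖v‖ ^ 2 / d) := by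
  have e : (fun x => (a + ⟪x, v⟫_ℝ) ^ 2)
      = fun x => (a ^ 2 + 2 * a * ⟪x, v⟫_ℝ) + ⟪x, v⟫_ℝ ^ 2 := by ext x; ring
  have i1 : Integrable (fun x => 2 * a * ⟪x, v⟫_ℝ) μ := (aux_int_inner hae v).const_mul _
  have i2 : Integrable (fun x => a ^ 2 + 2 * a * ⟪x, v⟫_ℝ) μ := (integrable_const _).add i1
  rw [← ofReal_integral_eq_lintegral_ofReal, e, integral_add i2 (aux_int_sq hae v),
    integral_add (integrable_const _) i1, integral_const_mul, aux_mean hinv,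
    aux_second hd hae hinv, ← ENNReal.ofReal_add (by positivity) (by positivity)]
  · simp
  · rw [e]; exact i2.add (aux_int_sq hae v)
  · exact Eventually.of_forall fun x => sq_nonneg _

lemma aux_B [IsProbabilityMeasure μ] (hae : ∀ᵐ x ∂μ, ‖x‖ = 1)
    (hinv : ∀ O : EuclideanSpace ℝ (Fin d) ≃ₗᵢ[ℝ] EuclideanSpace ℝ (Fin d),
        μ.map O = μ) (w : EuclideanSpace ℝ (Fin d)) :
    ∫⁻ x, ENNReal.ofReal (‖w + (2 : ℝ) • x‖ ^ 2) ∂μ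
      = ENNReal.ofReal (‖w‖ ^ 2) + ENNReal.ofReal 4 := by
  have e : (fun x => ‖w + (2 : ℝ) • x‖ ^ 2)
      =ᵐ[μ] fun x => (‖w‖ ^ 2 + 4) + 4 * ⟪x, w⟫_ℝ := by
    filter_upwards [hae] with x hx
    rw [norm_add_sq_real, inner_smul_right, norm_smul, hx, real_inner_comm]
    norm_num; ring
  have i1 : Integrable (fun x => 4 * ⟪x, w⟫_ℝ) μ := (aux_int_inner hae w).const_mul _
  rw [← ofReal_integral_eq_lintegral_ofReal, integral_congr_ae e,
    integral_add (integrable_const _) i1, integral_const_mul, aux_mean hinv,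
    ← ENNReal.ofReal_add (by positivity) (by positivity)]
  · simp
  · exact ((integrable_const _).add i1).congr e.symm
  · exact Eventually.of_forall fun x => sq_nonneg _

lemma aux_pi_s14 [IsProbabilityMeasure μ] (n : ℕ)
    (f : (Fin (n + 1) → EuclideanSpace ℝ (Fin d)) → ℝ≥0∞) (hf : Measurable f) :
    ∫⁻ c, f c ∂(Measure.pi fun _ : Fin (n + 1) => μ)
      = ∫⁻ c, ∫⁻ x, f (Fin.cons x c) ∂μ ∂(Measure.pi fun _ : Fin n => μ) := by
  have h := (measurePreserving_piFinSuccAbove (fun _ : Fin (n + 1) => μ) 0).symm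
  rw [← h.lintegral_comp hf, lintegral_prod_symm' (fun a => f ((MeasurableEquiv.piFinSuccAbove (fun _ => EuclideanSpace ℝ (Fin d)) 0).symm a)) (hf.comp h.measurable)]
  refine lintegral_congr fun c => lintegral_congr fun x => ?_
  congr 1
  simp [MeasurableEquiv.piFinSuccAbove_symm_apply, Fin.insertNthEquiv]

lemma aux_indB [IsProbabilityMeasure μ] (hae : ∀ᵐ x ∂μ, ‖x‖ = 1)
    (hinv : ∀ O : EuclideanSpace ℝ (Fin d) ≃ₗᵢ[ℝ] EuclideanSpace ℝ (Fin d),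
        μ.map O = μ) (y : EuclideanSpace ℝ (Fin d)) (n : ℕ) :
    ∫⁻ c, ENNReal.ofReal (‖y + (2 : ℝ) • ∑ i, c i‖ ^ 2) ∂(Measure.pi fun _ : Fin n => μ)
      = ENNReal.ofReal (‖y‖ ^ 2 + 4 * n) := by
  induction n with
  | zero => simp
  | succ n ih =>
    rw [aux_pi_s14 _ _ (by fun_prop)]
    have : ∀ (c : Fin n → EuclideanSpace ℝ (Fin d)),
      ∫⁻ x, ENNReal.ofReal (‖y + (2 : ℝ) • ∑ i, (Fin.cons x c : Fin (n + 1) → EuclideanSpace ℝ (Fin d)) i‖ ^ 2) ∂μ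
        = ENNReal.ofReal (‖y + (2 : ℝ) • ∑ i, c i‖ ^ 2) + ENNReal.ofReal 4 := by
      intro c
      rw [← aux_B hae hinv]
      congr 1; ext x
      rw [Fin.sum_univ_succ, Fin.cons_zero]
      simp only [Fin.cons_succ]
      congr 3
      module
    simp_rw [this]
    rw [lintegral_add_right _ (by fun_prop), ih, lintegral_const, measure_univ, mul_one,
      ← ENNReal.ofReal_add (by positivity) (by positivity)]
    push_cast
    ring_nf

lemma aux_indA [IsProbabilityMeasure μ] (hd : 1 ≤ d) (hae : ∀ᵐ x ∂μ, ‖x‖ = 1)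
    (hinv : ∀ O : EuclideanSpace ℝ (Fin d) ≃ₗᵢ[ℝ] EuclideanSpace ℝ (Fin d),
        μ.map O = μ) (y : EuclideanSpace ℝ (Fin d)) (n : ℕ) :
    ∫⁻ c, ENNReal.ofReal ((⟪∑ i, c i, y + ∑ i, c i⟫_ℝ - n) ^ 2) ∂(Measure.pi fun _ : Fin n => μ)
      ≤ ENNReal.ofReal ((n * ‖y‖ ^ 2 + 2 * n ^ 2) / d) := by
  induction n with
  | zero => simp
  | succ n ih =>
    rw [aux_pi_s14 _ _ (by fun_prop)]
    have : ∀ (c : Fin n → EuclideanSpace ℝ (Fin d)),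
      ∫⁻ x, ENNReal.ofReal ((⟪∑ i, (Fin.cons x c : Fin (n + 1) → EuclideanSpace ℝ (Fin d)) i,
          y + ∑ i, (Fin.cons x c : Fin (n + 1) → EuclideanSpace ℝ (Fin d)) i⟫_ℝ - (n + 1 : ℕ)) ^ 2) ∂μ
        = ENNReal.ofReal ((⟪∑ i, c i, y + ∑ i, c i⟫_ℝ - n) ^ 2)
          + ENNReal.ofReal (1 / d) * ENNReal.ofReal (‖y + (2 : ℝ) • ∑ i, c i‖ ^ 2) := by
      intro c
      rw [← ENNReal.ofReal_mul (by positivity), one_div_mul_eq_div, ← aux_A hd hae hinv]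
      apply lintegral_congr_ae
      filter_upwards [hae] with x hx
      rw [Fin.sum_univ_succ, Fin.cons_zero]
      simp only [Fin.cons_succ]
      congr 2
      have h1 : ⟪x, x⟫_ℝ = 1 := by rw [real_inner_self_eq_norm_sq, hx, one_pow]
      simp only [inner_add_left, inner_add_right, inner_smul_right, h1]
      rw [real_inner_comm x (∑ i, c i)]
      push_cast
      ring
    simp_rw [this]
    rw [lintegral_add_right _ (by fun_prop), lintegral_const_mul _ (by fun_prop),
      aux_indB hae hinv, ← ENNReal.ofReal_mul (by positivity)]
    refine (add_le_add_left ih _).trans ?_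
    rw [← ENNReal.ofReal_add (by positivity) (by positivity)]
    apply ENNReal.ofReal_le_ofReal
    rw [one_div_mul_eq_div, ← add_div]
    apply div_le_div_of_nonneg_right _ (Nat.cast_nonneg d)
    push_cast
    nlinarith

lemma aux_gauss1 : ∫⁻ x, ENNReal.ofReal (x ^ 2) ∂(gaussianReal 0 1) = 1 := by
  have h2 : MemLp (id : ℝ → ℝ) 2 (gaussianReal 0 1) := memLp_id_gaussianReal 2
  have h := variance_id_gaussianReal (μ := 0) (v := 1)
  rw [variance_of_integral_eq_zero (by fun_prop) (by simp)] at h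
  rw [← ofReal_integral_eq_lintegral_ofReal]
  · simp only [id] at h
    rw [h]; simp
  · exact h2.integrable_sq
  · exact Eventually.of_forall fun x => sq_nonneg _

instance aux_inst : IsProbabilityMeasure (stdGaussianE d) := by
  unfold stdGaussianE
  exact Measure.isProbabilityMeasure_map (by fun_prop)

lemma aux_gauss : ∫⁻ z, ENNReal.ofReal (‖z‖ ^ 2) ∂(stdGaussianE d) = d := by
  unfold stdGaussianE
  rw [lintegral_map (by fun_prop) (by fun_prop)]
  simp_rw [EuclideanSpace.real_norm_sq_eq]
  simp_rw [ENNReal.ofReal_sum_of_nonneg (fun _ _ => sq_nonneg _)]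
  rw [lintegral_finsetSum _ (fun i _ => by fun_prop)]
  have : ∀ i : Fin d, ∫⁻ z, ENNReal.ofReal (((EuclideanSpace.equiv (Fin d) ℝ).symm z) i ^ 2)
      ∂(Measure.pi fun _ : Fin d => gaussianReal 0 1) = 1 := by
    intro i
    rw [← aux_gauss1]
    exact (measurePreserving_eval (fun _ : Fin d => gaussianReal 0 1) i).lintegral_comp
      (f := fun x => ENNReal.ofReal (x ^ 2)) (by fun_prop)
  rw [Finset.sum_congr rfl (fun i _ => this i)]
  simp

lemma aux_total [IsProbabilityMeasure μ] (hd : 1 ≤ d) (hae : ∀ᵐ x ∂μ, ‖x‖ = 1)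
    (hinv : ∀ O : EuclideanSpace ℝ (Fin d) ≃ₗᵢ[ℝ] EuclideanSpace ℝ (Fin d),
        μ.map O = μ) (X : EuclideanSpace ℝ (Fin d)) (σ : ℝ) (n : ℕ) :
    ∫⁻ ω, ENNReal.ofReal ((∑ i, ⟪ω.1 i, rhoF d n X σ ω⟫_ℝ - n) ^ 2) ∂(canaryP d n μ)
      ≤ ENNReal.ofReal ((n * (2 * ‖X‖ ^ 2 + 2 * σ ^ 2 * d) + 2 * n ^ 2) / d) := by
  have hd' : (0 : ℝ) < d := by exact_mod_cast hd
  unfold canaryP rhoF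
  rw [lintegral_prod_symm' _ (by fun_prop)]
  calc _ ≤ ∫⁻ z, (ENNReal.ofReal ((n * (2 * ‖X‖ ^ 2) + 2 * n ^ 2) / d)
        + ENNReal.ofReal (n * (2 * σ ^ 2) / d) * ENNReal.ofReal (‖z‖ ^ 2)) ∂(stdGaussianE d) := by
        apply lintegral_mono
        intro z
        have := aux_indA hd hae hinv (X + σ • z) n
        refine le_trans (le_of_eq ?_) (this.trans ?_)
        · apply lintegral_congr
          intro c
          simp only
          rw [← sum_inner, add_right_comm]
        · beta_reduce
          rw [← ENNReal.ofReal_mul (by positivity),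
            ← ENNReal.ofReal_add (by positivity) (by positivity)]
          apply ENNReal.ofReal_le_ofReal
          rw [div_mul_eq_mul_div, ← add_div]
          apply div_le_div_of_nonneg_right _ hd'.le
          have h3 : ‖X + σ • z‖ ^ 2 ≤ 2 * ‖X‖ ^ 2 + 2 * σ ^ 2 * ‖z‖ ^ 2 := by
            have h4 := norm_add_le X (σ • z)
            have h5 : ‖σ • z‖ ^ 2 = σ ^ 2 * ‖z‖ ^ 2 := by
              rw [norm_smul, mul_pow, Real.norm_eq_abs, sq_abs]
            nlinarith [norm_nonneg (X + σ • z), sq_nonneg (‖X‖ - ‖σ • z‖)]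
          have : (0 : ℝ) ≤ n := by positivity
          nlinarith [mul_le_mul_of_nonneg_left h3 this]
    _ = _ := by
        rw [lintegral_add_left (by fun_prop)]
        rw [lintegral_const_mul _ (by fun_prop), aux_gauss, lintegral_const, measure_univ, mul_one,
          ← ENNReal.ofReal_natCast, ← ENNReal.ofReal_mul (by positivity),
          ← ENNReal.ofReal_add (by positivity) (by positivity)]
        congr 1
        field_simp
        ring

lemma aux_markov [IsProbabilityMeasure μ] (hd : 1 ≤ d) (hae : ∀ᵐ x ∂μ, ‖x‖ = 1)
    (hinv : ∀ O : EuclideanSpace ℝ (Fin d) ≃ₗᵢ[ℝ] EuclideanSpace ℝ (Fin d),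
        μ.map O = μ) (X : EuclideanSpace ℝ (Fin d)) (σ : ℝ) (n : ℕ) (hn : 0 < n)
    (ε : ℝ) (hε : 0 < ε) :
    canaryP d n μ {ω | ε ≤ |(1 / n : ℝ) * (∑ i, ⟪ω.1 i, rhoF d n X σ ω⟫_ℝ) - 1|}
      ≤ ENNReal.ofReal (((2 * (‖X‖ / √d) ^ 2 + 2 * σ ^ 2) * (n : ℝ)⁻¹ + 2 * (d : ℝ)⁻¹) / ε ^ 2) := by
  have hd' : (0 : ℝ) < d := by exact_mod_cast hd
  have hn' : (0 : ℝ) < n := by exact_mod_cast hn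
  have hpos : 0 < (n * ε) ^ 2 := by positivity
  have hm : Measurable fun ω : (Fin n → EuclideanSpace ℝ (Fin d)) × EuclideanSpace ℝ (Fin d) =>
      ENNReal.ofReal ((∑ i, ⟪ω.1 i, rhoF d n X σ ω⟫_ℝ - n) ^ 2) := by
    unfold rhoF; fun_prop
  have h1 := meas_ge_le_lintegral_div (μ := canaryP d n μ) hm.aemeasurable
    (ε := ENNReal.ofReal ((n * ε) ^ 2)) (ENNReal.ofReal_pos.2 hpos).ne' ENNReal.ofReal_ne_top
  refine le_trans (measure_mono ?_) (h1.trans ((ENNReal.div_le_div_right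
    (aux_total hd hae hinv X σ n) _).trans (le_of_eq ?_)))
  · intro ω hω
    simp only [Set.mem_ofPred_eq] at hω ⊢
    apply ENNReal.ofReal_le_ofReal
    rw [← sq_abs (∑ i, _ - _)]
    gcongr
    set T := ∑ i, ⟪ω.1 i, rhoF d n X σ ω⟫_ℝ
    have : T - n = n * (1 / n * T - 1) := by field_simp
    rw [this, abs_mul, abs_of_pos hn']
    gcongr
  · rw [← ENNReal.ofReal_div_of_pos hpos, div_pow ‖X‖, Real.sq_sqrt hd'.le]
    congr 1
    field_simp

end helpers

/-- Under the asymptotic one-shot random-canary setup, the average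
canary–output inner product `(1/k) ∑ᵢ ⟪c_{di}, ρ_d⟫` converges in probability to `1`
as `d → ∞`. -/
theorem avg_canary_inner_tendsto_in_probability
    (X : ∀ d : ℕ, EuclideanSpace ℝ (Fin d))
    (hX : (fun d : ℕ => ‖X d‖) =o[atTop] fun d : ℕ => Real.sqrt d)
    (k : ℕ → ℕ)
    (hk₁ : Tendsto (fun d : ℕ => (k d : ℝ)) atTop atTop)
    (hk₂ : Tendsto (fun d : ℕ => (k d : ℝ) / d) atTop (𝓝 0))
    (σ : ℝ) (hσ : 0 < σ)
    (μs : ∀ d : ℕ, Measure (EuclideanSpace ℝ (Fin d)))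
    (hprob : ∀ d, 1 ≤ d → IsProbabilityMeasure (μs d))
    (hsphere : ∀ d, 1 ≤ d → μs d (Metric.sphere (0 : EuclideanSpace ℝ (Fin d)) 1) = 1)
    (hinv : ∀ d, 1 ≤ d →
      ∀ O : EuclideanSpace ℝ (Fin d) ≃ₗᵢ[ℝ] EuclideanSpace ℝ (Fin d),
        (μs d).map O = μs d)
    :
    ∀ ε : ℝ, 0 < ε →
      Tendsto (fun d : ℕ =>
          canaryP d (k d) (μs d)
            {ω | ε ≤ |(1 / (k d) : ℝ) *
              (∑ i, ⟪ω.1 i, rhoF d (k d) (X d) σ ω⟫_ℝ) - 1|})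
        atTop (𝓝 0) := by
  intro ε hε
  have hd : Tendsto (fun d : ℕ => (d : ℝ)) atTop atTop := tendsto_natCast_atTop_atTop
  have hX' := hX.tendsto_div_nhds_zero
  have hlim : Tendsto (fun d : ℕ => ENNReal.ofReal
      (((2 * (‖X d‖ / √d) ^ 2 + 2 * σ ^ 2) * (k d : ℝ)⁻¹ + 2 * (d : ℝ)⁻¹) / ε ^ 2))
      atTop (𝓝 0) := by
    have h := (((((hX'.pow 2).const_mul 2).add_const (2 * σ ^ 2)).mul
      (tendsto_inv_atTop_zero.comp hk₁)).add
      ((tendsto_inv_atTop_zero.comp hd).const_mul 2)).div_const (ε ^ 2)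
    have h2 := ENNReal.tendsto_ofReal h
    simpa using h2
  refine tendsto_of_tendsto_of_tendsto_of_le_of_le' tendsto_const_nhds hlim
    (Eventually.of_forall fun _ => zero_le) ?_
  filter_upwards [eventually_ge_atTop 1, hk₁.eventually_gt_atTop 0] with d h1 hk
  haveI := hprob d h1
  exact aux_markov h1 (aux_ae (hsphere d h1)) (hinv d h1) (X d) σ (k d) (by exact_mod_cast hk) ε hε
end

section
/- Under the asymptotic one-shot random-canary setup, the rescaled empirical mean of the canary cosines satisfies √d · μ̂_d → 1/σ in probability as d → ∞, where μ̂_d = (1/k) Σ_{i=1}^k ⟨c_{di}, ρ_d⟩/‖ρ_d‖. -/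
open MeasureTheory ProbabilityTheory Real Filter
open scoped InnerProductSpace Topology ENNReal

section Sphere

variable {d : ℕ} {μ : Measure (EuclideanSpace ℝ (Fin d))} [IsProbabilityMeasure μ]

lemma integrable_cont_of_sphere (h1 : ∀ᵐ c ∂μ, ‖c‖ = 1)
    {F : EuclideanSpace ℝ (Fin d) → ℝ} (hF : Continuous F) : Integrable F μ := by
  obtain ⟨C, hC⟩ := (isCompact_closedBall (0 : EuclideanSpace ℝ (Fin d)) 1).exists_bound_of_continuousOn
    hF.continuousOn
  refine Integrable.of_bound hF.aestronglyMeasurable C ?_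
  filter_upwards [h1] with c hc
  exact hC c (by simp [hc])

lemma sphere_mean (hinv : ∀ O : EuclideanSpace ℝ (Fin d) ≃ₗᵢ[ℝ] EuclideanSpace ℝ (Fin d),
    μ.map O = μ) (v : EuclideanSpace ℝ (Fin d)) : ∫ c, ⟪c, v⟫_ℝ ∂μ = 0 := by
  have h : ∫ c, ⟪c, v⟫_ℝ ∂μ = ∫ c, ⟪-c, v⟫_ℝ ∂μ := by
    conv_lhs => rw [← hinv (LinearIsometryEquiv.neg ℝ)]
    rw [integral_map (by fun_prop) (by fun_prop)]
    rfl
  simp only [inner_neg_left, integral_neg] at h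
  linarith

lemma sphere_sq (hd : 1 ≤ d) (h1 : ∀ᵐ c ∂μ, ‖c‖ = 1)
    (hinv : ∀ O : EuclideanSpace ℝ (Fin d) ≃ₗᵢ[ℝ] EuclideanSpace ℝ (Fin d),
    μ.map O = μ) (v : EuclideanSpace ℝ (Fin d)) :
    ∫ c, ⟪c, v⟫_ℝ ^ 2 ∂μ = ‖v‖ ^ 2 / d := by
  have key : ∀ v w : EuclideanSpace ℝ (Fin d), ‖v‖ = ‖w‖ →
      ∫ c, ⟪c, v⟫_ℝ ^ 2 ∂μ = ∫ c, ⟪c, w⟫_ℝ ^ 2 ∂μ := by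
    intro v w h
    have hr := Submodule.reflection_sub h
    set R := (ℝ ∙ (v - w))ᗮ.reflection with hR
    conv_rhs => rw [← hinv R]
    rw [integral_map (by fun_prop) (by fun_prop)]
    congr 1; ext c
    rw [← hr, LinearIsometryEquiv.inner_map_map]
  have hsum : ∑ i : Fin d, ∫ c, ⟪c, EuclideanSpace.single i (1 : ℝ)⟫_ℝ ^ 2 ∂μ = 1 := by
    rw [← integral_finsetSum]
    · have : ∀ᵐ c ∂μ, ∑ i : Fin d, ⟪c, EuclideanSpace.single i (1 : ℝ)⟫_ℝ ^ 2 = 1 := by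
        filter_upwards [h1] with c hc
        have := EuclideanSpace.real_norm_sq_eq c
        simp [EuclideanSpace.inner_single_right]
        rw [← this, hc]; norm_num
      rw [integral_congr_ae this]; simp
    · intro i _
      exact integrable_cont_of_sphere h1 (by fun_prop)
  let e : EuclideanSpace ℝ (Fin d) := EuclideanSpace.single ⟨0, hd⟩ (1 : ℝ)
  have he : ‖e‖ = 1 := by simp [e]
  have h2 : (d : ℝ) * ∫ c, ⟪c, e⟫_ℝ ^ 2 ∂μ = 1 := by
    rw [← hsum, Finset.sum_congr rfl (fun i _ => key (EuclideanSpace.single i (1 : ℝ)) e (by simp [he]))]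
    simp
  have hd0 : (d : ℝ) ≠ 0 := by positivity
  rw [key v (‖v‖ • e) (by simp [norm_smul, he])]
  simp only [inner_smul_right, mul_pow, integral_const_mul]
  field_simp
  linear_combination ‖v‖ ^ 2 * h2

lemma pi_ae_norm (h1 : ∀ᵐ c ∂μ, ‖c‖ = 1) (n : ℕ) :
    ∀ᵐ c ∂(Measure.pi fun _ : Fin n => μ), ‖∑ i, c i‖ ≤ n := by
  have : ∀ᵐ c ∂(Measure.pi fun _ : Fin n => μ), ∀ i, ‖c i‖ = 1 := by
    rw [ae_all_iff]
    intro i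
    exact (measurePreserving_eval (fun _ : Fin n => μ) i).quasiMeasurePreserving.ae h1
  filter_upwards [this] with c hc
  refine (norm_sum_le _ _).trans ?_
  simp [hc]

lemma integrable_sum (h1 : ∀ᵐ c ∂μ, ‖c‖ = 1) (n : ℕ)
    {F : EuclideanSpace ℝ (Fin d) → ℝ} (hF : Continuous F) :
    Integrable (fun c : Fin n → EuclideanSpace ℝ (Fin d) => F (∑ i, c i))
      (Measure.pi fun _ : Fin n => μ) := by
  obtain ⟨C, hC⟩ := (isCompact_closedBall (0 : EuclideanSpace ℝ (Fin d)) n).exists_bound_of_continuousOn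
    hF.continuousOn
  refine Integrable.of_bound (Continuous.aestronglyMeasurable (by fun_prop)) C ?_
  filter_upwards [pi_ae_norm h1 n] with c hc
  exact hC _ (by simpa using hc)

lemma integral_sum_succ (h1 : ∀ᵐ c ∂μ, ‖c‖ = 1) (n : ℕ)
    {F : EuclideanSpace ℝ (Fin d) → ℝ} (hF : Continuous F) :
    ∫ c, F (∑ i, c i) ∂(Measure.pi fun _ : Fin (n + 1) => μ) =
      ∫ s, ∫ c, F (c + ∑ i, s i) ∂μ ∂(Measure.pi fun _ : Fin n => μ) := by
  have hmp := measurePreserving_piFinSuccAbove (fun _ : Fin (n + 1) => μ) 0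
  have hi := integrable_sum h1 (n + 1) hF
  have he : (fun c : Fin (n+1) → EuclideanSpace ℝ (Fin d) => F (∑ i, c i)) =
      (fun p : EuclideanSpace ℝ (Fin d) × (Fin n → EuclideanSpace ℝ (Fin d)) =>
        F (p.1 + ∑ i, p.2 i)) ∘
      (MeasurableEquiv.piFinSuccAbove (fun _ : Fin (n+1) => EuclideanSpace ℝ (Fin d)) 0) := by
    ext c
    simp [Fin.sum_univ_succ, MeasurableEquiv.piFinSuccAbove, Fin.tail]
  have hi2 : Integrable (fun p : EuclideanSpace ℝ (Fin d) × (Fin n → EuclideanSpace ℝ (Fin d)) =>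
        F (p.1 + ∑ i, p.2 i)) (μ.prod (Measure.pi fun _ : Fin n => μ)) := by
    rw [he] at hi
    exact (hmp.integrable_comp_emb (MeasurableEquiv.measurableEmbedding _)).1 hi
  have hs := MeasureTheory.integral_prod_symm _ hi2
  refine Eq.trans ?_ hs
  rw [he]
  exact hmp.integral_comp (MeasurableEquiv.measurableEmbedding _)
    (fun p : EuclideanSpace ℝ (Fin d) × (Fin n → EuclideanSpace ℝ (Fin d)) => F (p.1 + ∑ i, p.2 i))

lemma quad_expand (hd : 1 ≤ d) (h1 : ∀ᵐ c ∂μ, ‖c‖ = 1)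
    (hinv : ∀ O : EuclideanSpace ℝ (Fin d) ≃ₗᵢ[ℝ] EuclideanSpace ℝ (Fin d), μ.map O = μ)
    (v : EuclideanSpace ℝ (Fin d)) (a b : ℝ) :
    ∫ c, (a + b * ⟪c, v⟫_ℝ) ^ 2 ∂μ = a ^ 2 + b ^ 2 * (‖v‖ ^ 2 / d) := by
  have i1 : Integrable (fun c => ⟪c, v⟫_ℝ) μ := integrable_cont_of_sphere h1 (by fun_prop)
  have i2 : Integrable (fun c => ⟪c, v⟫_ℝ ^ 2) μ := integrable_cont_of_sphere h1 (by fun_prop)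
  have : ∀ c, (a + b * ⟪c, v⟫_ℝ) ^ 2 = (a ^ 2 + (2 * a * b) * ⟪c, v⟫_ℝ) + b ^ 2 * ⟪c, v⟫_ℝ ^ 2 := by
    intro c; ring
  simp_rw [this]
  have i3 : Integrable (fun c => a ^ 2 + (2 * a * b) * ⟪c, v⟫_ℝ) μ :=
    (integrable_const _).add (i1.const_mul _)
  rw [integral_add i3 (i2.const_mul _),
    integral_add (integrable_const _) (i1.const_mul _), integral_const_mul, integral_const_mul,
    sphere_sq hd h1 hinv, sphere_mean hinv]
  simp

lemma sum_inner_sq (hd : 1 ≤ d) (h1 : ∀ᵐ c ∂μ, ‖c‖ = 1)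
    (hinv : ∀ O : EuclideanSpace ℝ (Fin d) ≃ₗᵢ[ℝ] EuclideanSpace ℝ (Fin d), μ.map O = μ)
    (v : EuclideanSpace ℝ (Fin d)) (n : ℕ) :
    ∫ c, ⟪∑ i, c i, v⟫_ℝ ^ 2 ∂(Measure.pi fun _ : Fin n => μ) = n * ‖v‖ ^ 2 / d := by
  induction n with
  | zero => simp
  | succ n ih =>
    rw [integral_sum_succ h1 n (F := fun s => ⟪s, v⟫_ℝ ^ 2) (by fun_prop)]
    have : ∀ s : Fin n → EuclideanSpace ℝ (Fin d), ∫ c, ⟪c + ∑ i, s i, v⟫_ℝ ^ 2 ∂μ =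
        ⟪∑ i, s i, v⟫_ℝ ^ 2 + ‖v‖ ^ 2 / d := by
      intro s
      have := quad_expand hd h1 hinv v ⟪∑ i, s i, v⟫_ℝ 1
      rw [one_pow, one_mul] at this
      rw [← this]
      congr 1; ext c; rw [inner_add_left]; ring
    simp_rw [this]
    rw [integral_add (integrable_sum h1 n (F := fun s => ⟪s, v⟫_ℝ ^ 2) (by fun_prop))
      (integrable_const _), ih]
    simp; ring

lemma sum_norm_sq (hd : 1 ≤ d) (h1 : ∀ᵐ c ∂μ, ‖c‖ = 1)
    (hinv : ∀ O : EuclideanSpace ℝ (Fin d) ≃ₗᵢ[ℝ] EuclideanSpace ℝ (Fin d), μ.map O = μ)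
    (n : ℕ) :
    ∫ c, ‖∑ i, c i‖ ^ 2 ∂(Measure.pi fun _ : Fin n => μ) = n := by
  have : ∀ c : Fin n → EuclideanSpace ℝ (Fin d), ‖∑ i, c i‖ ^ 2 =
      ∑ j : Fin d, ⟪∑ i, c i, EuclideanSpace.single j (1 : ℝ)⟫_ℝ ^ 2 := by
    intro c
    rw [EuclideanSpace.real_norm_sq_eq]
    simp [EuclideanSpace.inner_single_right]
  simp_rw [this]
  rw [integral_finsetSum]
  · simp_rw [sum_inner_sq hd h1 hinv]
    have hd0 : (d : ℝ) ≠ 0 := by positivity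
    simp
    field_simp
  · intro j _
    exact integrable_sum h1 n (F := fun s => ⟪s, EuclideanSpace.single j (1 : ℝ)⟫_ℝ ^ 2) (by fun_prop)

lemma sum_norm_var (hd : 1 ≤ d) (h1 : ∀ᵐ c ∂μ, ‖c‖ = 1)
    (hinv : ∀ O : EuclideanSpace ℝ (Fin d) ≃ₗᵢ[ℝ] EuclideanSpace ℝ (Fin d), μ.map O = μ)
    (n : ℕ) :
    ∫ c, (‖∑ i, c i‖ ^ 2 - n) ^ 2 ∂(Measure.pi fun _ : Fin n => μ) = 2 * n * (n - 1) / d := by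
  induction n with
  | zero => simp
  | succ n ih =>
    rw [integral_sum_succ h1 n (F := fun s => (‖s‖ ^ 2 - ((n + 1 : ℕ) : ℝ)) ^ 2) (by fun_prop)]
    have : ∀ s : Fin n → EuclideanSpace ℝ (Fin d),
        ∫ c, (‖c + ∑ i, s i‖ ^ 2 - ((n + 1 : ℕ) : ℝ)) ^ 2 ∂μ =
        (‖∑ i, s i‖ ^ 2 - n) ^ 2 + (4 / d) * ‖∑ i, s i‖ ^ 2 := by
      intro s
      have := quad_expand hd h1 hinv (∑ i, s i) (‖∑ i, s i‖ ^ 2 - n) 2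
      rw [show (4 / (d:ℝ)) * ‖∑ i, s i‖ ^ 2 = 2 ^ 2 * (‖∑ i, s i‖ ^ 2 / d) by ring, ← this]
      apply integral_congr_ae
      filter_upwards [h1] with c hc
      rw [norm_add_sq_real, hc]
      push_cast; ring
    simp_rw [this]
    rw [integral_add (integrable_sum h1 n (F := fun s => (‖s‖ ^ 2 - (n : ℝ)) ^ 2) (by fun_prop))
      ((integrable_sum h1 n (F := fun s => ‖s‖ ^ 2) (by fun_prop)).const_mul _), ih,
      integral_const_mul, sum_norm_sq hd h1 hinv]
    push_cast; ring

end Sphere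

section Gauss

instance (d : ℕ) : IsProbabilityMeasure (stdGaussianE d) :=
  Measure.isProbabilityMeasure_map (by fun_prop)

lemma memLp_sq_gauss : MemLp (fun x : ℝ => x ^ 2) 2 (gaussianReal 0 1) := by
  rw [memLp_two_iff_integrable_sq (by fun_prop)]
  have h := (memLp_id_gaussianReal' (μ := 0) (v := 1) 4 (by simp)).integrable_norm_pow (p := 4) (by simp)
  refine h.congr (ae_of_all _ fun x => ?_)
  simp only [id, Real.norm_eq_abs]
  rw [Even.pow_abs (by decide)]; ring

lemma gauss_sq_mean : ∫ x : ℝ, x ^ 2 ∂(gaussianReal 0 1) = 1 := by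
  have h := variance_fun_id_gaussianReal (μ := 0) (v := 1)
  rw [variance_of_integral_eq_zero (by fun_prop) (by simp)] at h
  simpa using h

lemma gauss_integral (d : ℕ) (f : EuclideanSpace ℝ (Fin d) → ℝ) (hf : Continuous f) :
    ∫ z, f z ∂(stdGaussianE d) =
      ∫ x, f (WithLp.toLp 2 x) ∂(Measure.pi fun _ : Fin d => gaussianReal 0 1) := by
  rw [stdGaussianE, integral_map (by fun_prop) hf.aestronglyMeasurable]
  rfl

lemma gauss_memLp (d : ℕ) : MemLp (fun x : Fin d → ℝ => ∑ i, x i ^ 2) 2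
    (Measure.pi fun _ : Fin d => gaussianReal 0 1) := by
  refine memLp_finsetSum _ fun i _ => ?_
  exact memLp_sq_gauss.comp_measurePreserving (measurePreserving_eval (fun _ : Fin d => gaussianReal 0 1) i)

lemma gauss_pi_mean (d : ℕ) : ∫ x : Fin d → ℝ, ∑ i, x i ^ 2
    ∂(Measure.pi fun _ : Fin d => gaussianReal 0 1) = d := by
  have hi : ∀ i, ∫ x : Fin d → ℝ, x i ^ 2 ∂(Measure.pi fun _ : Fin d => gaussianReal 0 1) = 1 := by
    intro i
    have h := integral_map (μ := Measure.pi fun _ : Fin d => gaussianReal 0 1)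
      (φ := Function.eval i) (f := fun x : ℝ => x ^ 2)
      (measurable_pi_apply i).aemeasurable (by fun_prop)
    rw [(measurePreserving_eval (fun _ : Fin d => gaussianReal 0 1) i).map_eq, gauss_sq_mean] at h
    exact h.symm
  rw [integral_finsetSum]
  · simp [hi]
  · intro i _
    exact (memLp_sq_gauss.comp_measurePreserving
      (measurePreserving_eval (fun _ : Fin d => gaussianReal 0 1) i)).integrable (by norm_num)

lemma gauss_mean (d : ℕ) : ∫ z, ‖z‖ ^ 2 ∂(stdGaussianE d) = d := by
  rw [gauss_integral d _ (by fun_prop), ← gauss_pi_mean d]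
  simp [EuclideanSpace.real_norm_sq_eq]

lemma gauss_var (d : ℕ) : ∫ z, (‖z‖ ^ 2 - d) ^ 2 ∂(stdGaussianE d) =
    d * Var[fun x : ℝ => x ^ 2; gaussianReal 0 1] := by
  rw [gauss_integral d _ (by fun_prop)]
  have h := variance_sum_pi (μ := fun _ : Fin d => gaussianReal 0 1) (X := fun _ x => x ^ 2)
    (fun _ => memLp_sq_gauss)
  have h' : (∑ i : Fin d, fun ω : Fin d → ℝ => ω i ^ 2) = fun ω => ∑ i, ω i ^ 2 := by
    ext; simp
  rw [h', variance_eq_integral (Measurable.aemeasurable (by fun_prop)), gauss_pi_mean] at h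
  simp only [EuclideanSpace.real_norm_sq_eq]
  rw [h]; simp

lemma gauss_integrable_sq (d : ℕ) : Integrable (fun z => ‖z‖ ^ 2) (stdGaussianE d) := by
  rw [stdGaussianE, integrable_map_measure (Continuous.aestronglyMeasurable (by fun_prop)) (by fun_prop)]
  refine ((gauss_memLp d).integrable (by norm_num)).congr (ae_of_all _ fun x => ?_)
  simp [EuclideanSpace.real_norm_sq_eq]

lemma gauss_integrable_var (d : ℕ) :
    Integrable (fun z => (‖z‖ ^ 2 - (d : ℝ)) ^ 2) (stdGaussianE d) := by
  rw [stdGaussianE, integrable_map_measure (Continuous.aestronglyMeasurable (by fun_prop)) (by fun_prop)]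
  refine (((gauss_memLp d).sub (memLp_const (d : ℝ))).integrable_sq).congr (ae_of_all _ fun x => ?_)
  simp [EuclideanSpace.real_norm_sq_eq]

end Gauss

section InProb

/-- convergence in probability to a constant along varying probability spaces -/
def InP {Ω : ℕ → Type} [∀ d, MeasurableSpace (Ω d)] (P : ∀ d, Measure (Ω d))
    (f : ∀ d, Ω d → ℝ) (a : ℝ) : Prop :=
  ∀ ε : ℝ, 0 < ε → Tendsto (fun d => P d {ω | ε ≤ |f d ω - a|}) atTop (𝓝 0)

variable {Ω : ℕ → Type} [∀ d, MeasurableSpace (Ω d)] {P : ∀ d, Measure (Ω d)}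
  {f g : ∀ d, Ω d → ℝ} {a b : ℝ}

lemma InP.map2 (hf : InP P f a) (hg : InP P g b) (h : ℝ → ℝ → ℝ)
    (hc : ContinuousAt (fun p : ℝ × ℝ => h p.1 p.2) (a, b)) :
    InP P (fun d ω => h (f d ω) (g d ω)) (h a b) := by
  intro ε hε
  obtain ⟨δ, hδ, H⟩ := Metric.continuousAt_iff.1 hc ε hε
  have hs := (hf δ hδ).add (hg δ hδ)
  rw [add_zero] at hs
  refine tendsto_of_tendsto_of_tendsto_of_le_of_le tendsto_const_nhds hs (fun _ => zero_le) ?_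
  intro d
  refine le_trans (measure_mono ?_) (measure_union_le _ _)
  intro ω hω
  by_contra hcon
  simp only [Set.mem_union, Set.mem_ofPred_eq, not_or, not_le] at hcon hω
  have := H (x := (f d ω, g d ω)) (by
    rw [Prod.dist_eq]; exact max_lt (by simpa [Real.dist_eq] using hcon.1) (by simpa [Real.dist_eq] using hcon.2))
  rw [Real.dist_eq] at this
  exact absurd hω (not_le.2 this)

lemma InP.squeeze (hg : InP P g b) (h : ∀ d ω, |f d ω - a| ≤ |g d ω - b|) : InP P f a := by
  intro ε hε
  refine tendsto_of_tendsto_of_tendsto_of_le_of_le tendsto_const_nhds (hg ε hε) (fun _ => zero_le) ?_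
  intro d
  exact measure_mono fun ω hω => le_trans (α := ℝ) hω (h d ω)

lemma InP.const {x : ℕ → ℝ} (hx : Tendsto x atTop (𝓝 a)) : InP P (fun d _ => x d) a := by
  intro ε hε
  refine tendsto_const_nhds.congr' ?_
  filter_upwards [Metric.tendsto_nhds.1 hx ε hε] with d hd
  rw [Real.dist_eq] at hd
  simp [not_le.2 hd]

lemma InP.of_sq {B : ℕ → ℝ} (hB : Tendsto B atTop (𝓝 0))
    (h : ∀ᶠ d in atTop, Measurable (f d) ∧
      ∫⁻ ω, ENNReal.ofReal ((f d ω - a) ^ 2) ∂(P d) ≤ ENNReal.ofReal (B d)) : InP P f a := by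
  intro ε hε
  have hl : Tendsto (fun d => ENNReal.ofReal (B d / ε ^ 2)) atTop (𝓝 0) := by
    have := ENNReal.tendsto_ofReal (hB.div_const (ε ^ 2))
    simpa using this
  refine tendsto_of_tendsto_of_tendsto_of_le_of_le' tendsto_const_nhds hl
    (Eventually.of_forall fun _ => zero_le) ?_
  filter_upwards [h] with d hd
  have hm := hd.1
  have hp : 0 < ε ^ 2 := by positivity
  rw [ENNReal.ofReal_div_of_pos hp]
  refine le_trans (le_trans (measure_mono ?_) (meas_ge_le_lintegral_div
    (f := fun ω => ENNReal.ofReal ((f d ω - a) ^ 2)) (μ := P d) (ε := ENNReal.ofReal (ε ^ 2))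
    (Measurable.aemeasurable (by fun_prop)) (by simpa using hε.ne') (by simp))) ?_
  · intro ω hω
    apply ENNReal.ofReal_le_ofReal
    rw [← sq_abs (f d ω - a)]
    exact pow_le_pow_left₀ hε.le hω 2
  · gcongr
    exact hd.2

end InProb

lemma lint_fst {α β : Type*} [MeasurableSpace α] [MeasurableSpace β] (μ : Measure α) (ν : Measure β)
    [IsProbabilityMeasure μ] [IsProbabilityMeasure ν] (F : α → ℝ) (hF : Measurable F)
    (hi : Integrable F μ) (h0 : ∀ x, 0 ≤ F x) :
    ∫⁻ ω, ENNReal.ofReal (F ω.1) ∂(μ.prod ν) = ENNReal.ofReal (∫ x, F x ∂μ) := by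
  rw [lintegral_prod _ (Measurable.aemeasurable (by fun_prop)),
    ofReal_integral_eq_lintegral_ofReal hi (ae_of_all _ h0)]
  simp

lemma lint_snd {α β : Type*} [MeasurableSpace α] [MeasurableSpace β] (μ : Measure α) (ν : Measure β)
    [IsProbabilityMeasure μ] [IsProbabilityMeasure ν] (F : β → ℝ) (hF : Measurable F)
    (hi : Integrable F ν) (h0 : ∀ x, 0 ≤ F x) :
    ∫⁻ ω, ENNReal.ofReal (F ω.2) ∂(μ.prod ν) = ENNReal.ofReal (∫ x, F x ∂ν) := by
  rw [lintegral_prod _ (Measurable.aemeasurable (by fun_prop)),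
    ofReal_integral_eq_lintegral_ofReal hi (ae_of_all _ h0)]
  simp

/-- Under the asymptotic one-shot random-canary setup, the rescaled
empirical mean of the canary cosines satisfies `√d · μ̂_d → 1/σ` in probability as
`d → ∞`, where `μ̂_d = (1/k) ∑ᵢ ⟪c_{di}, ρ_d⟫ / ‖ρ_d‖`. -/
theorem rescaled_empirical_mean_tendsto_in_probability
    (X : ∀ d : ℕ, EuclideanSpace ℝ (Fin d))
    (hX : (fun d : ℕ => ‖X d‖) =o[atTop] fun d : ℕ => Real.sqrt d)
    (k : ℕ → ℕ)
    (hk₁ : Tendsto (fun d : ℕ => (k d : ℝ)) atTop atTop)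
    (hk₂ : Tendsto (fun d : ℕ => (k d : ℝ) / d) atTop (𝓝 0))
    (σ : ℝ) (hσ : 0 < σ)
    (μs : ∀ d : ℕ, Measure (EuclideanSpace ℝ (Fin d)))
    (hprob : ∀ d, 1 ≤ d → IsProbabilityMeasure (μs d))
    (hsphere : ∀ d, 1 ≤ d → μs d (Metric.sphere (0 : EuclideanSpace ℝ (Fin d)) 1) = 1)
    (hinv : ∀ d, 1 ≤ d →
      ∀ O : EuclideanSpace ℝ (Fin d) ≃ₗᵢ[ℝ] EuclideanSpace ℝ (Fin d),
        (μs d).map O = μs d)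
    :
    ∀ ε : ℝ, 0 < ε →
      Tendsto (fun d : ℕ =>
          canaryP d (k d) (μs d)
            {ω | ε ≤ |Real.sqrt d * muHat d (k d) (X d) σ ω - 1 / σ|})
        atTop (𝓝 0) := by
  have h1 : ∀ d, 1 ≤ d → ∀ᵐ c ∂(μs d), ‖c‖ = 1 := by
    intro d hd
    have := hprob d hd
    have := (prob_compl_eq_zero_iff (μ := μs d) (Metric.isClosed_sphere.measurableSet)).2 (hsphere d hd)
    rw [ae_iff]
    convert this using 2
    ext c; simp
  have hd1 : ∀ᶠ d : ℕ in atTop, 1 ≤ d := eventually_ge_atTop 1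
  have hkpos : ∀ᶠ d : ℕ in atTop, (0 : ℝ) < k d := hk₁.eventually_gt_atTop 0
  have hdinv : Tendsto (fun d : ℕ => (d : ℝ)⁻¹) atTop (𝓝 0) :=
    tendsto_inv_atTop_zero.comp tendsto_natCast_atTop_atTop
  have hkinv : Tendsto (fun d : ℕ => (k d : ℝ)⁻¹) atTop (𝓝 0) :=
    tendsto_inv_atTop_zero.comp hk₁
  have hx : Tendsto (fun d : ℕ => ‖X d‖ / √d) atTop (𝓝 0) := hX.tendsto_div_nhds_zero
  let P := fun d => canaryP d (k d) (μs d)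
  have hU : InP P (fun d ω => ‖∑ i, ω.1 i‖ ^ 2 / k d) 1 := by
    refine InP.of_sq (B := fun d => 2 * (d : ℝ)⁻¹) (by simpa using hdinv.const_mul 2) ?_
    filter_upwards [hd1, hkpos] with d hd hk
    have := hprob d hd
    refine ⟨by fun_prop, ?_⟩
    have hi : Integrable (fun c : Fin (k d) → EuclideanSpace ℝ (Fin d) =>
        (‖∑ i, c i‖ ^ 2 / k d - 1) ^ 2) (Measure.pi fun _ : Fin (k d) => μs d) :=
      integrable_sum (h1 d hd) (k d) (F := fun s => (‖s‖ ^ 2 / (k d : ℝ) - 1) ^ 2) (by fun_prop)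
    refine (lint_fst _ (stdGaussianE d) _ (by fun_prop) hi (fun _ => sq_nonneg _)).le.trans ?_
    apply ENNReal.ofReal_le_ofReal
    have : ∀ c : Fin (k d) → EuclideanSpace ℝ (Fin d), (‖∑ i, c i‖ ^ 2 / k d - 1) ^ 2 =
        ((k d : ℝ) ^ 2)⁻¹ * (‖∑ i, c i‖ ^ 2 - k d) ^ 2 := by
      intro c; field_simp
    simp_rw [this]
    rw [integral_const_mul, sum_norm_var hd (h1 d hd) (hinv d hd)]
    have hd0 : (0 : ℝ) < d := by positivity
    field_simp
    linarith
  have hT : InP P (fun d ω => ⟪∑ i, ω.1 i, X d + σ • ω.2⟫_ℝ / k d) 0 := by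
    refine InP.of_sq (B := fun d => (2 * (‖X d‖ / √d) ^ 2 + 2 * σ ^ 2) * (k d : ℝ)⁻¹)
      (by simpa using (((hx.pow 2).const_mul 2).add_const (2 * σ ^ 2)).mul hkinv) ?_
    filter_upwards [hd1, hkpos] with d hd hk
    have := hprob d hd
    have hd0 : (0 : ℝ) < d := by positivity
    refine ⟨by fun_prop, ?_⟩
    refine (lintegral_prod_symm (μ := Measure.pi fun _ : Fin (k d) => μs d) (ν := stdGaussianE d)
      _ (Measurable.aemeasurable (by fun_prop))).le.trans ?_
    have hin : ∀ z : EuclideanSpace ℝ (Fin d), ∫⁻ c : Fin (k d) → EuclideanSpace ℝ (Fin d),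
        ENNReal.ofReal ((⟪∑ i, c i, X d + σ • z⟫_ℝ / k d - 0) ^ 2) ∂(Measure.pi fun _ : Fin (k d) => μs d)
        ≤ ENNReal.ofReal ((k d * d : ℝ)⁻¹ * (2 * ‖X d‖ ^ 2 + 2 * σ ^ 2 * ‖z‖ ^ 2)) := by
      intro z
      have hi : Integrable (fun c : Fin (k d) → EuclideanSpace ℝ (Fin d) =>
          (⟪∑ i, c i, X d + σ • z⟫_ℝ / k d - 0) ^ 2) (Measure.pi fun _ : Fin (k d) => μs d) :=
        integrable_sum (h1 d hd) (k d) (F := fun s => (⟪s, X d + σ • z⟫_ℝ / (k d : ℝ) - 0) ^ 2)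
          (by fun_prop)
      rw [← ofReal_integral_eq_lintegral_ofReal hi (ae_of_all _ fun _ => sq_nonneg _)]
      apply ENNReal.ofReal_le_ofReal
      have : ∀ c : Fin (k d) → EuclideanSpace ℝ (Fin d), (⟪∑ i, c i, X d + σ • z⟫_ℝ / k d - 0) ^ 2 =
          ((k d : ℝ) ^ 2)⁻¹ * ⟪∑ i, c i, X d + σ • z⟫_ℝ ^ 2 := by
        intro c; field_simp; ring
      simp_rw [this]
      rw [integral_const_mul, sum_inner_sq hd (h1 d hd) (hinv d hd)]
      have hn : ‖X d + σ • z‖ ^ 2 ≤ 2 * ‖X d‖ ^ 2 + 2 * σ ^ 2 * ‖z‖ ^ 2 := by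
        have h := norm_add_le (X d) (σ • z)
        rw [norm_smul, Real.norm_eq_abs, abs_of_pos hσ] at h
        have h2 := pow_le_pow_left₀ (norm_nonneg _) h 2
        nlinarith [sq_nonneg (‖X d‖ - σ * ‖z‖)]
      have : ((k d : ℝ) ^ 2)⁻¹ * (k d * ‖X d + σ • z‖ ^ 2 / d) = (k d * d : ℝ)⁻¹ * ‖X d + σ • z‖ ^ 2 := by
        field_simp
      rw [this]
      gcongr
    refine (lintegral_mono hin).trans ?_
    have hgi := gauss_integrable_sq d
    have hgi2 : Integrable (fun z : EuclideanSpace ℝ (Fin d) =>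
        (k d * d : ℝ)⁻¹ * (2 * ‖X d‖ ^ 2 + 2 * σ ^ 2 * ‖z‖ ^ 2)) (stdGaussianE d) :=
      ((integrable_const _).add (hgi.const_mul _)).const_mul _
    rw [← ofReal_integral_eq_lintegral_ofReal hgi2
      (ae_of_all _ fun z => by positivity)]
    apply ENNReal.ofReal_le_ofReal
    rw [integral_const_mul, integral_add (integrable_const _) (hgi.const_mul _),
      integral_const_mul, integral_const_mul, gauss_mean, div_pow, Real.sq_sqrt hd0.le]
    simp only [integral_const, probReal_univ, one_smul]
    apply le_of_eq
    field_simp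
  have hV : InP P (fun d ω => ‖ω.2‖ ^ 2 / d) 1 := by
    refine InP.of_sq (B := fun d => Var[fun x : ℝ => x ^ 2; gaussianReal 0 1] * (d : ℝ)⁻¹)
      (by simpa using hdinv.const_mul _) ?_
    filter_upwards [hd1] with d hd
    have := hprob d hd
    have hd0 : (0 : ℝ) < d := by positivity
    refine ⟨by fun_prop, ?_⟩
    have : ∀ z : EuclideanSpace ℝ (Fin d), (‖z‖ ^ 2 / d - 1) ^ 2 =
        ((d : ℝ) ^ 2)⁻¹ * (‖z‖ ^ 2 - d) ^ 2 := by
      intro c; field_simp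
    simp_rw [this]
    refine (lint_snd (Measure.pi fun _ : Fin (k d) => μs d) (stdGaussianE d)
      (fun z => ((d : ℝ) ^ 2)⁻¹ * (‖z‖ ^ 2 - d) ^ 2) (by fun_prop)
      ((gauss_integrable_var d).const_mul _) (fun _ => by positivity)).le.trans ?_
    apply ENNReal.ofReal_le_ofReal
    rw [integral_const_mul, gauss_var]
    apply le_of_eq
    field_simp
  have hW : InP P (fun d ω => ‖∑ i, ω.1 i‖ / √d) 0 := by
    refine InP.of_sq (B := fun d => (k d : ℝ) / d) hk₂ ?_
    filter_upwards [hd1] with d hd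
    have := hprob d hd
    have hd0 : (0 : ℝ) < d := by positivity
    refine ⟨by fun_prop, ?_⟩
    have hi : Integrable (fun c : Fin (k d) → EuclideanSpace ℝ (Fin d) =>
        (‖∑ i, c i‖ / √d - 0) ^ 2) (Measure.pi fun _ : Fin (k d) => μs d) :=
      integrable_sum (h1 d hd) (k d) (F := fun s => (‖s‖ / √d - 0) ^ 2) (by fun_prop)
    refine (lint_fst _ (stdGaussianE d) _ (by fun_prop) hi (fun _ => sq_nonneg _)).le.trans ?_
    apply ENNReal.ofReal_le_ofReal
    simp_rw [sub_zero, div_pow, Real.sq_sqrt hd0.le]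
    rw [integral_div, sum_norm_sq hd (h1 d hd) (hinv d hd)]
  have hB : InP P (fun d ω => ‖rhoF d (k d) (X d) σ ω‖ / √d) σ := by
    have e1 := (hV.map2 hW (fun v w => |σ * √v - σ| + w) (by fun_prop)).map2
      (InP.const (P := P) hx) (fun a b => a + b) (by fun_prop)
    have e0 : |σ * √1 - σ| + 0 + 0 = (0 : ℝ) := by simp
    rw [e0] at e1
    refine e1.squeeze fun d ω => ?_
    rw [sub_zero]
    refine le_trans ?_ (le_abs_self _)
    have hs : √(‖ω.2‖ ^ 2 / d) = ‖ω.2‖ / √d := by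
      rw [Real.sqrt_div (by positivity), Real.sqrt_sq (norm_nonneg _)]
    rw [hs]
    have hr : |‖rhoF d (k d) (X d) σ ω‖ - σ * ‖ω.2‖| ≤ ‖X d‖ + ‖∑ i, ω.1 i‖ := by
      have h := abs_norm_sub_norm_le (rhoF d (k d) (X d) σ ω) (σ • ω.2)
      rw [norm_smul, Real.norm_eq_abs, abs_of_pos hσ] at h
      refine h.trans ?_
      simp only [rhoF, add_sub_cancel_right]
      exact norm_add_le _ _
    have hr2 : |‖rhoF d (k d) (X d) σ ω‖ / √d - σ * (‖ω.2‖ / √d)| ≤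
        ‖∑ i, ω.1 i‖ / √d + ‖X d‖ / √d := by
      rw [show ‖rhoF d (k d) (X d) σ ω‖ / √d - σ * (‖ω.2‖ / √d) =
        (‖rhoF d (k d) (X d) σ ω‖ - σ * ‖ω.2‖) / √d by ring, abs_div,
        abs_of_nonneg (Real.sqrt_nonneg _), ← add_div]
      gcongr
      linarith
    have := abs_sub_le (‖rhoF d (k d) (X d) σ ω‖ / √d) (σ * (‖ω.2‖ / √d)) σ
    linarith
  have hfin := (hU.map2 hT (fun u t => u + t) (by fun_prop)).map2 hB (fun a b => a / b)
    (by
      apply ContinuousAt.div continuousAt_fst continuousAt_snd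
      exact hσ.ne')
  simp only [add_zero] at hfin
  have heq : ∀ (d : ℕ) ω, √(d : ℝ) * muHat d (k d) (X d) σ ω =
      (‖∑ i, ω.1 i‖ ^ 2 / k d + ⟪∑ i, ω.1 i, X d + σ • ω.2⟫_ℝ / k d) /
        (‖rhoF d (k d) (X d) σ ω‖ / √d) := by
    intro d ω
    have hn : ‖∑ i, ω.1 i‖ ^ 2 + ⟪∑ i, ω.1 i, X d + σ • ω.2⟫_ℝ =
        ⟪∑ i, ω.1 i, rhoF d (k d) (X d) σ ω⟫_ℝ := by
      rw [← real_inner_self_eq_norm_sq, ← inner_add_right]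
      congr 1
      simp only [rhoF]; abel
    rw [← add_div, hn, muHat]
    simp only [cosStat]
    rw [← Finset.sum_div, ← sum_inner, div_div_eq_mul_div]
    ring
  intro ε hε
  have := hfin ε hε
  simp_rw [← heq] at this
  exact this
end
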